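/- arXiv:2202.00318 — 2 statements merged into one kernel-verified Lean document; each statement's English description precedes it below -/
import Mathlib

section
/- Let 2 < s < 3 and 0 < α ≤ 1, and set c_s = -π / (Γ(s) · cos(sπ/2)). Then lim_{t → ∞} t^{α/(s-1)} · (1/2π) ∫_{-π}^{π} E_α(-t^α · l_s(k)) dk = (1/(π(s-1))) · c_s^{-1/(s-1)} · ∫_0^∞ u^{(2-s)/(s-1)} E_α(-u) du, where the last integral converges. That is, the maximum f_max(t) = f_0(t) of the fundamental solution of the generalized diffusion equation on the infinite path graph decays as t^{-γ} with γ = α/(s-1). -/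
open Real Filter MeasureTheory Set

/-- The Mittag-Leffler function `E_α(x) = ∑_{j=0}^∞ x^j / Γ(α j + 1)`. -/
noncomputable def mittagLeffler (α x : ℝ) : ℝ :=
  ∑' j : ℕ, x ^ j / Real.Gamma (α * j + 1)

/-- `l_s(k) = 2 ∑_{d=1}^∞ d^{-s} (1 - cos(dk))`. -/
noncomputable def lsFun (s k : ℝ) : ℝ :=
  2 * ∑' d : ℕ+, (d : ℝ) ^ (-s) * (1 - Real.cos (d * k))

lemma ml_ratio {α : ℝ} (hα : 0 < α) {x : ℝ} (hx : 1 < x) :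
    (x - 1) ^ α * Real.Gamma x ≤ Real.Gamma (x + α) := by
  have h := Real.convexOn_log_Gamma.slope_mono_adjacent (x := x - 1) (y := x) (z := x + α)
    (by simp; linarith) (by simp; linarith) (by linarith) (by linarith)
  have h0 : 0 < x - 1 := by linarith
  have hg : Real.Gamma x = (x - 1) * Real.Gamma (x - 1) := by
    have := Real.Gamma_add_one h0.ne'
    simpa using this
  have p1 := Real.Gamma_pos_of_pos h0
  have p2 : 0 < Real.Gamma x := Real.Gamma_pos_of_pos (by linarith)
  have p3 : 0 < Real.Gamma (x + α) := Real.Gamma_pos_of_pos (by linarith)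
  simp only [Function.comp] at h
  have e1 : Real.log (Real.Gamma x) - Real.log (Real.Gamma (x - 1)) = Real.log (x - 1) := by
    rw [hg, Real.log_mul h0.ne' p1.ne']; ring
  rw [e1, sub_sub_cancel, div_one, add_sub_cancel_left, le_div_iff₀ hα] at h
  rw [← Real.log_le_log_iff (by positivity) p3, Real.log_mul (by positivity) p2.ne',
    Real.log_rpow h0]
  linarith

lemma ml_summable {α : ℝ} (hα : 0 < α) (x : ℝ) :
    Summable (fun j : ℕ => x ^ j / Real.Gamma (α * j + 1)) := by
  rcases eq_or_ne x 0 with rfl | hx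
  · apply summable_of_ne_finset_zero (s := {0})
    intro b hb
    simp at hb
    simp [hb]
  have gp : ∀ j : ℕ, 0 < Real.Gamma (α * j + 1) := fun j => Real.Gamma_pos_of_pos (by positivity)
  apply summable_of_ratio_test_tendsto_lt_one (l := 0) one_pos
  · filter_upwards with j
    exact div_ne_zero (pow_ne_zero _ hx) (gp j).ne'
  · have hlim : Tendsto (fun j : ℕ => |x| / (α * j) ^ α) atTop (nhds 0) := by
      apply Tendsto.div_atTop tendsto_const_nhds
      exact (tendsto_rpow_atTop hα).comp
        (Tendsto.const_mul_atTop hα tendsto_natCast_atTop_atTop)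
    refine squeeze_zero' (Eventually.of_forall fun j => by positivity) ?_ hlim
    filter_upwards [eventually_ge_atTop 1] with j hj
    have hj' : (0 : ℝ) < j := by exact_mod_cast hj
    have hr := ml_ratio hα (x := α * j + 1) (by nlinarith [mul_pos hα hj'])
    have e : α * ((j + 1 : ℕ) : ℝ) + 1 = α * j + 1 + α := by push_cast; ring
    rw [add_sub_cancel_right] at hr
    have gq : 0 < Real.Gamma (α * j + 1 + α) := by rw [← e]; exact gp _
    rw [e, norm_div, norm_div, norm_pow, norm_pow, Real.norm_eq_abs, Real.norm_eq_abs,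
      Real.norm_eq_abs, abs_of_pos (gp j), abs_of_pos gq]
    have hx' : 0 < |x| := abs_pos.mpr hx
    have : |x| ^ (j + 1) / Real.Gamma (α * j + 1 + α) / (|x| ^ j / Real.Gamma (α * j + 1))
      = |x| * Real.Gamma (α * j + 1) / Real.Gamma (α * j + 1 + α) := by
      have := (gp j).ne'
      field_simp
      ring
    rw [this, div_le_div_iff₀ gq (by positivity)]
    nlinarith

lemma ml_lipschitz {α : ℝ} (hα : 0 < α) {R : ℝ} (hR : 1 ≤ R) :
    ∃ L : ℝ, 0 ≤ L ∧ ∀ x y : ℝ, |x| ≤ R → |y| ≤ R →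
      |mittagLeffler α x - mittagLeffler α y| ≤ L * |x - y| := by
  have gp : ∀ j : ℕ, 0 < Real.Gamma (α * j + 1) := fun j => Real.Gamma_pos_of_pos (by positivity)
  refine ⟨∑' j : ℕ, (2 * R) ^ j / Real.Gamma (α * j + 1),
    tsum_nonneg fun j => div_nonneg (by positivity) (gp j).le, ?_⟩
  intro x y hx hy
  unfold mittagLeffler
  rw [← (ml_summable hα x).tsum_sub (ml_summable hα y), ← Real.norm_eq_abs, ← tsum_mul_right]
  refine tsum_of_norm_bounded ((ml_summable hα (2 * R)).mul_right |x - y|).hasSum ?_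
  intro j
  rw [← sub_div, norm_div, Real.norm_eq_abs, Real.norm_eq_abs, abs_of_pos (gp j), div_mul_eq_mul_div]
  gcongr
  refine (abs_pow_sub_pow_le _ _ _).trans ?_
  have h1 : max |x| |y| ^ (j - 1) ≤ R ^ j :=
    (pow_le_pow_left₀ (by positivity) (max_le hx hy) _).trans (pow_le_pow_right₀ hR (by omega))
  have h2 : (j : ℝ) ≤ 2 ^ j := by exact_mod_cast (Nat.lt_two_pow_self (n := j)).le
  calc |x - y| * j * max |x| |y| ^ (j - 1) ≤ |x - y| * 2 ^ j * R ^ j := by gcongr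
    _ = _ := by rw [mul_pow]; ring

lemma ml_continuous {α : ℝ} (hα : 0 < α) : Continuous (mittagLeffler α) := by
  rw [continuous_iff_continuousAt]
  intro x
  obtain ⟨L, hL, h⟩ := ml_lipschitz hα (R := |x| + 1) (by linarith [abs_nonneg x])
  rw [ContinuousAt, tendsto_iff_norm_sub_tendsto_zero]
  have : Tendsto (fun y => L * |y - x|) (nhds x) (nhds 0) := by
    have : Continuous (fun y : ℝ => L * |y - x|) := by fun_prop
    simpa using this.tendsto x
  refine squeeze_zero' (Eventually.of_forall fun j => by positivity) ?_ this
  filter_upwards [Metric.ball_mem_nhds x one_pos] with y hy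
  rw [Metric.mem_ball, Real.dist_eq] at hy
  apply h
  · have := abs_sub_abs_le_abs_sub y x
    linarith
  · linarith

lemma ml_zero (α : ℝ) : mittagLeffler α 0 = 1 := by
  unfold mittagLeffler
  rw [tsum_eq_single 0]
  · simp
  · intro j hj; simp [hj]

lemma ml_one (x : ℝ) : mittagLeffler 1 x = Real.exp x := by
  unfold mittagLeffler
  rw [Real.exp_eq_exp_ℝ, NormedSpace.exp_eq_tsum_div]
  simp [Real.Gamma_nat_eq_factorial]

lemma beta_conv {a b t : ℝ} (ha : 0 < a) (hb : 0 < b) (ht : 0 < t) :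
    ∫ x in (0:ℝ)..t, (t - x) ^ (a - 1) * x ^ (b - 1) =
      t ^ (a + b - 1) * (Real.Gamma a * Real.Gamma b / Real.Gamma (a + b)) := by
  have h := Complex.betaIntegral_scaled b a ht
  rw [Complex.betaIntegral_eq_Gamma_mul_div _ _ (by simpa) (by simpa)] at h
  have h2 : ((∫ x in (0:ℝ)..t, (t - x) ^ (a - 1) * x ^ (b - 1) : ℝ) : ℂ) =
      ∫ x in (0:ℝ)..t, (x:ℂ) ^ ((b:ℂ) - 1) * ((t:ℂ) - x) ^ ((a:ℂ) - 1) := by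
    rw [← intervalIntegral.integral_ofReal]
    apply intervalIntegral.integral_congr
    intro x hx
    rw [uIcc_of_le ht.le] at hx
    simp only []
    rw [Complex.ofReal_mul, Complex.ofReal_cpow (by linarith [hx.2]), Complex.ofReal_cpow hx.1]
    push_cast
    ring
  rw [← h2] at h
  rw [← Complex.ofReal_add, Complex.Gamma_ofReal, Complex.Gamma_ofReal, Complex.Gamma_ofReal] at h
  have h3 : ((t:ℂ) ^ (((b + a : ℝ) : ℂ) - 1)) = ((t ^ (a + b - 1) : ℝ) : ℂ) := by
    rw [Complex.ofReal_cpow ht.le]; push_cast; ring_nf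
  rw [h3] at h
  rw [add_comm b a, mul_comm (Complex.ofReal (Real.Gamma b))] at h
  exact_mod_cast h

lemma kern_int {a t : ℝ} (ha : 0 < a) (u : ℝ) :
    IntervalIntegrable (fun x => (t - x) ^ (a - 1)) volume u t := by
  have h := (intervalIntegral.intervalIntegrable_rpow' (a := t - u) (b := 0) (r := a - 1)
    (by linarith)).comp_sub_left t
  simpa using h

lemma kern_integral {a t u : ℝ} (ha : 0 < a) :
    ∫ x in u..t, (t - x) ^ (a - 1) = (t - u) ^ a / a := by
  rw [intervalIntegral.integral_comp_sub_left (fun x => x ^ (a - 1)) t, sub_self,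
    integral_rpow (by left; linarith)]
  simp [Real.zero_rpow ha.ne']


lemma volterra_contra {α κ t0 D : ℝ} (hα : 0 < α) (hα1 : α < 1) (hκ : 0 < κ) (ht0 : 0 < t0)
    (h q : ℝ → ℝ)
    (hint : ∀ t, 0 < t → IntervalIntegrable (fun x => (t - x) ^ (α - 1) * h x) volume 0 t)
    (heq : ∀ t, 0 < t → h t + κ * ∫ x in (0:ℝ)..t, (t - x) ^ (α - 1) * h x = q t)
    (hpos : ∀ t, 0 < t → t < t0 → 0 < h t) (h0 : h t0 = 0)
    (hO : ∃ M : ℝ, 0 ≤ M ∧ ∀ᶠ t in nhdsWithin t0 (Iio t0), h t ≤ M * (t0 - t))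
    (hD : HasDerivAt (fun t => t ^ (1 - α) * q t) D t0) (hDpos : 0 < D) : False := by
  obtain ⟨M, hM, hO⟩ := hO
  obtain ⟨c, hc, hcO⟩ := (mem_nhdsLT_iff_exists_Ioo_subset' (show (0:ℝ) < t0 from ht0)).1 hO
  -- quantitative inequality
  set C := κ * t0 ^ (1 - α) * M / α with hC
  have key : ∀ t ∈ Ioo (max c 0) t0,
      t0 ^ (1 - α) * q t0 - t ^ (1 - α) * q t ≤ C * (t0 - t) ^ α * (t0 - t) := by
    intro t ht
    have htp : 0 < t := lt_of_le_of_lt (le_max_right _ _) ht.1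
    have htc : c < t := lt_of_le_of_lt (le_max_left _ _) ht.1
    have I0 := hint t0 ht0
    have sub1 : uIcc 0 t ⊆ uIcc 0 t0 := by
      rw [uIcc_of_le htp.le, uIcc_of_le ht0.le]; exact Icc_subset_Icc le_rfl ht.2.le
    have sub2 : uIcc t t0 ⊆ uIcc 0 t0 := by
      rw [uIcc_of_le ht.2.le, uIcc_of_le ht0.le]; exact Icc_subset_Icc htp.le le_rfl
    have I1 := I0.mono_set sub1
    have I2 := I0.mono_set sub2
    have hsplit := intervalIntegral.integral_add_adjacent_intervals I1 I2
    have e0 := heq t0 ht0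
    rw [h0, zero_add, ← hsplit] at e0
    have e1 := heq t htp
    have b1 : t0 ^ (1 - α) * ∫ x in (0:ℝ)..t, (t0 - x) ^ (α - 1) * h x ≤
        t ^ (1 - α) * ∫ x in (0:ℝ)..t, (t - x) ^ (α - 1) * h x := by
      rw [← intervalIntegral.integral_const_mul, ← intervalIntegral.integral_const_mul]
      apply intervalIntegral.integral_mono_on_of_le_Ioo htp.le (I1.const_mul _)
        ((hint t htp).const_mul _)
      intro x hx
      have hh := hpos x hx.1 (hx.2.trans ht.2)
      have hx1 : 0 < t - x := by linarith [hx.2]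
      have hx2 : 0 < t0 - x := by linarith [hx.2, ht.2]
      rw [← mul_assoc, ← mul_assoc]
      refine mul_le_mul_of_nonneg_right ?_ hh.le
      have r1 : ∀ y : ℝ, 0 < y → y ^ (α - 1) = (y ^ (1 - α))⁻¹ := by
        intro y hy; rw [← Real.rpow_neg hy.le]; ring_nf
      rw [r1 _ hx1, r1 _ hx2, ← div_eq_mul_inv, ← div_eq_mul_inv,
        div_le_div_iff₀ (by positivity) (by positivity),
        ← Real.mul_rpow ht0.le hx1.le, ← Real.mul_rpow htp.le hx2.le]
      apply Real.rpow_le_rpow (by positivity) _ (by linarith)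
      nlinarith [hx.1, ht.2]
    have b2 : ∫ x in t..t0, (t0 - x) ^ (α - 1) * h x ≤ M * (t0 - t) * ((t0 - t) ^ α / α) := by
      rw [← kern_integral hα, ← intervalIntegral.integral_const_mul]
      apply intervalIntegral.integral_mono_on_of_le_Ioo ht.2.le I2
        ((kern_int hα _).const_mul _)
      intro x hx
      have hh := hcO (show x ∈ Ioo c t0 from ⟨htc.trans hx.1, hx.2⟩)
      simp only [mem_ofPred_eq] at hh
      have hx2 : 0 < t0 - x := by linarith [hx.2]
      have : h x ≤ M * (t0 - t) := hh.trans (by gcongr; exact hx.1.le)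
      rw [mul_comm]
      gcongr
    have hq := hpos t htp ht.2
    have tp : 0 < t ^ (1 - α) := by positivity
    have t0p : 0 < t0 ^ (1 - α) := by positivity
    have e2 : t ^ (1 - α) * q t = t ^ (1 - α) * h t +
      κ * (t ^ (1 - α) * ∫ x in (0:ℝ)..t, (t - x) ^ (α - 1) * h x) := by rw [← e1]; ring
    rw [e2, ← e0]
    have b1' := mul_le_mul_of_nonneg_left b1 hκ.le
    have b2' := mul_le_mul_of_nonneg_left b2 (mul_pos hκ t0p).le
    have : C * (t0 - t) ^ α * (t0 - t) = κ * t0 ^ (1 - α) * (M * (t0 - t) * ((t0 - t) ^ α / α)) := by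
      rw [hC]; ring
    rw [this]
    nlinarith [mul_pos tp hq]
  have hslope := (hasDerivAt_iff_tendsto_slope.1 hD).mono_left
    (nhdsWithin_mono t0 (show Iio t0 ⊆ {t0}ᶜ from fun x hx => ne_of_lt hx))
  have hlim : Tendsto (fun t => C * (t0 - t) ^ α) (nhdsWithin t0 (Iio t0)) (nhds 0) := by
    have : ContinuousAt (fun t => C * (t0 - t) ^ α) t0 := by
      apply ContinuousAt.mul continuousAt_const
      apply ContinuousAt.rpow_const (by fun_prop)
      right; exact hα.le
    have h2 := this.tendsto
    simp only [sub_self, Real.zero_rpow hα.ne', mul_zero] at h2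
    exact h2.mono_left nhdsWithin_le_nhds
  have : D ≤ 0 := by
    refine le_of_tendsto_of_tendsto hslope hlim ?_
    filter_upwards [Ioo_mem_nhdsLT (show max c 0 < t0 from max_lt hc ht0)] with t ht
    have := key t ht
    rw [slope_def_field, div_le_iff_of_neg (by linarith [ht.2])]
    linarith
  linarith

lemma ml_volterra_int {α t : ℝ} (hα : 0 < α) (a : ℝ) :
    IntervalIntegrable (fun x => (t - x) ^ (α - 1) * mittagLeffler α (-(x ^ α))) volume a t := by
  apply (kern_int hα a).mul_continuousOn
  apply Continuous.continuousOn
  apply (ml_continuous hα).comp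
  exact (Real.continuous_rpow_const hα.le).neg

lemma ml_volterra {α t : ℝ} (hα : 0 < α) (ht : 0 < t) :
    mittagLeffler α (-(t ^ α)) + (1 / Real.Gamma α) *
      ∫ x in (0:ℝ)..t, (t - x) ^ (α - 1) * mittagLeffler α (-(x ^ α)) = 1 := by
  have gp : ∀ j : ℕ, 0 < Real.Gamma (α * j + 1) := fun j => Real.Gamma_pos_of_pos (by positivity)
  have ga := Real.Gamma_pos_of_pos hα
  have hs := intervalIntegral.hasSum_integral_of_dominated_convergence (μ := volume)
    (a := 0) (b := t)
    (F := fun (j : ℕ) (x : ℝ) => (t - x) ^ (α - 1) * ((-(x ^ α)) ^ j / Real.Gamma (α * j + 1)))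
    (f := fun x => (t - x) ^ (α - 1) * mittagLeffler α (-(x ^ α)))
    (fun (j : ℕ) (x : ℝ) => (t - x) ^ (α - 1) * ((t ^ α) ^ j / Real.Gamma (α * j + 1)))
    (fun j => by
      refine Measurable.aestronglyMeasurable ?_
      fun_prop)
    (fun j => by
      filter_upwards with x hx
      rw [uIoc_of_le ht.le] at hx
      have h1 : 0 ≤ t - x := by linarith [hx.2]
      rw [norm_mul, norm_div, norm_pow, norm_neg, Real.norm_of_nonneg (Real.rpow_nonneg h1 _),
        Real.norm_of_nonneg (gp j).le, Real.norm_of_nonneg (Real.rpow_nonneg hx.1.le _)]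
      have := gp j
      have := hx.1
      have := hx.2
      gcongr)
    (by
      filter_upwards with x hx
      exact (ml_summable hα (t ^ α)).mul_left _)
    (by
      simp_rw [tsum_mul_left]
      exact (kern_int hα 0).mul_const _)
    (by
      filter_upwards with x hx
      exact (ml_summable hα _).hasSum.mul_left _)
  have hterm : ∀ j : ℕ, ∫ x in (0:ℝ)..t, (t - x) ^ (α - 1) * ((-(x ^ α)) ^ j / Real.Gamma (α * j + 1))
      = -Real.Gamma α * ((-(t ^ α)) ^ (j + 1) / Real.Gamma (α * (j + 1 : ℕ) + 1)) := by
    intro j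
    have e : ∀ x ∈ uIcc 0 t, (t - x) ^ (α - 1) * ((-(x ^ α)) ^ j / Real.Gamma (α * j + 1)) =
        ((-1) ^ j / Real.Gamma (α * j + 1)) * ((t - x) ^ (α - 1) * x ^ (α * j + 1 - 1)) := by
      intro x hx
      rw [uIcc_of_le ht.le] at hx
      rw [neg_pow, ← Real.rpow_natCast (x ^ α), ← Real.rpow_mul hx.1, add_sub_cancel_right]
      ring
    rw [intervalIntegral.integral_congr e, intervalIntegral.integral_const_mul,
      beta_conv hα (by positivity) ht, neg_pow (t ^ α), ← Real.rpow_natCast (t ^ α), ← Real.rpow_mul ht.le]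
    have e1 : α + (α * j + 1) - 1 = α * (j + 1 : ℕ) := by push_cast; ring
    have e2 : α + (α * j + 1) = α * (j + 1 : ℕ) + 1 := by push_cast; ring
    rw [e1, e2, pow_succ]
    have := (gp j).ne'
    field_simp
  have h1 := hs.tsum_eq
  simp_rw [hterm] at h1
  rw [tsum_mul_left] at h1
  have h2 := (ml_summable hα (-(t ^ α))).tsum_eq_zero_add
  rw [← h1]
  nth_rewrite 1 [mittagLeffler]
  rw [h2]
  have := ga.ne'
  simp
  field_simp
  ring

lemma first_zero {h : ℝ → ℝ} (hc : ContinuousOn h (Ioi 0)) {a t1 : ℝ} (ha : 0 < a)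
    (hpos : ∀ t, 0 < t → t ≤ a → 0 < h t) (ht1 : 0 < t1) (h1 : h t1 ≤ 0) :
    ∃ t0, 0 < t0 ∧ h t0 = 0 ∧ ∀ t, 0 < t → t < t0 → 0 < h t := by
  have hat : a < t1 := by
    by_contra hcon
    exact absurd (hpos t1 ht1 (not_lt.1 hcon)) (not_lt.2 h1)
  have hca : ContinuousOn h (Icc a t1) := hc.mono fun x hx => lt_of_lt_of_le ha hx.1
  have hcl : IsClosed (Icc a t1 ∩ h ⁻¹' Iic 0) := hca.preimage_isClosed_of_isClosed isClosed_Icc isClosed_Iic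
  have hcomp : IsCompact (Icc a t1 ∩ h ⁻¹' Iic 0) :=
    isCompact_Icc.of_isClosed_subset hcl inter_subset_left
  obtain ⟨t0, ⟨ht0m, ht0le⟩, hleast⟩ := hcomp.exists_isLeast ⟨t1, ⟨hat.le, le_rfl⟩, h1⟩
  have ht0 : 0 < t0 := lt_of_lt_of_le ha ht0m.1
  have hbefore : ∀ t, 0 < t → t < t0 → 0 < h t := by
    intro t ht htt
    by_contra hcon
    rcases le_or_gt t a with hta | hta
    · exact hcon (hpos t ht hta)
    · have := hleast ⟨⟨hta.le, htt.le.trans ht0m.2⟩, not_lt.1 hcon⟩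
      linarith
  refine ⟨t0, ht0, le_antisymm ht0le ?_, hbefore⟩
  have hct : Tendsto h (nhdsWithin t0 (Iio t0)) (nhds (h t0)) :=
    (hc.continuousAt (Ioi_mem_nhds ht0)).tendsto.mono_left nhdsWithin_le_nhds
  refine ge_of_tendsto hct ?_
  filter_upwards [Ioo_mem_nhdsLT ht0] with t ht
  exact (hbefore t ht.1 ht.2).le

lemma lip_of_deriv {g : ℝ → ℝ} {d t0 : ℝ} (hg : HasDerivAt g d t0) :
    ∃ M : ℝ, 0 ≤ M ∧ ∀ᶠ t in nhdsWithin t0 (Iio t0), |g t - g t0| ≤ M * (t0 - t) := by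
  obtain ⟨M, hM, h⟩ := hg.differentiableAt.isBigO_sub.exists_pos
  refine ⟨M, hM.le, ?_⟩
  filter_upwards [h.bound.filter_mono nhdsWithin_le_nhds, self_mem_nhdsWithin] with t ht htt
  have htt' : t < t0 := htt
  rw [Real.norm_eq_abs, Real.norm_eq_abs, abs_sub_comm t t0, abs_of_pos (sub_pos.2 htt')] at ht
  exact ht

lemma ml_lip_local {α t0 : ℝ} (hα : 0 < α) (ht0 : 0 < t0) :
    ∃ M : ℝ, 0 ≤ M ∧ ∀ᶠ t in nhdsWithin t0 (Iio t0),
      |mittagLeffler α (-(t ^ α)) - mittagLeffler α (-(t0 ^ α))| ≤ M * (t0 - t) := by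
  obtain ⟨M, hM, h⟩ := lip_of_deriv (Real.hasDerivAt_rpow_const (x := t0) (p := α) (Or.inl ht0.ne'))
  obtain ⟨L, hL, h'⟩ := ml_lipschitz hα (R := t0 ^ α + 1) (by linarith [Real.rpow_nonneg ht0.le α])
  refine ⟨L * M, by positivity, ?_⟩
  filter_upwards [h, Ioo_mem_nhdsLT ht0] with t h1 h2
  have p1 := Real.rpow_nonneg ht0.le α
  have p2 := Real.rpow_nonneg h2.1.le α
  have p3 := Real.rpow_le_rpow h2.1.le h2.2.le hα.le
  refine (h' _ _ (by rw [abs_neg, abs_of_nonneg p2]; linarith)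
    (by rw [abs_neg, abs_of_nonneg p1]; linarith)).trans ?_
  rw [mul_assoc]
  gcongr
  rw [neg_sub_neg, abs_sub_comm]
  exact h1

lemma mlt_cont {α : ℝ} (hα : 0 < α) : Continuous (fun t : ℝ => mittagLeffler α (-(t ^ α))) :=
  (ml_continuous hα).comp (Real.continuous_rpow_const hα.le).neg

lemma ml_pos_aux {α : ℝ} (hα : 0 < α) (hα1 : α < 1) {t : ℝ} (ht : 0 < t) :
    0 < mittagLeffler α (-(t ^ α)) := by
  by_contra hcon
  have hc := mlt_cont hα
  have h0 : ∀ᶠ t in nhds (0:ℝ), 0 < mittagLeffler α (-(t ^ α)) := by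
    have : mittagLeffler α (-((0:ℝ) ^ α)) = 1 := by
      rw [Real.zero_rpow hα.ne', neg_zero, ml_zero]
    exact hc.continuousAt.eventually_const_lt (by show 0 < mittagLeffler α (-((0:ℝ) ^ α)); rw [this]; exact one_pos)
  obtain ⟨a, ha, hball⟩ := Metric.eventually_nhds_iff.1 h0
  obtain ⟨t0, ht0, hz, hb⟩ := first_zero (h := fun t => mittagLeffler α (-(t ^ α)))
    hc.continuousOn (half_pos ha)
    (fun t h1 h2 => hball (by rw [Real.dist_eq, sub_zero, abs_of_pos h1]; linarith)) ht
    (not_lt.1 hcon)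
  have hD := (Real.hasDerivAt_rpow_const (x := t0) (p := 1 - α) (Or.inl ht0.ne')).mul_const 1
  refine volterra_contra hα hα1 (one_div_pos.2 (Real.Gamma_pos_of_pos hα)) ht0 _ (fun _ => 1)
    (fun t _ => ml_volterra_int hα 0) (fun t ht => ml_volterra hα ht) hb hz ?_ hD ?_
  · obtain ⟨M, hM, h⟩ := ml_lip_local hα ht0
    refine ⟨M, hM, ?_⟩
    filter_upwards [h] with t ht
    have hz' : mittagLeffler α (-(t0 ^ α)) = 0 := hz
    rw [hz', sub_zero] at ht
    exact (le_abs_self _).trans ht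
  · have : 0 < 1 - α := by linarith
    positivity

lemma ml_le_one_aux {α : ℝ} (hα : 0 < α) (hα1 : α < 1) {t : ℝ} (ht : 0 < t) :
    mittagLeffler α (-(t ^ α)) ≤ 1 := by
  have h := ml_volterra hα ht
  have : 0 ≤ ∫ x in (0:ℝ)..t, (t - x) ^ (α - 1) * mittagLeffler α (-(x ^ α)) := by
    apply intervalIntegral.integral_nonneg_of_ae_restrict ht.le
    rw [Filter.EventuallyLE, ae_restrict_iff' measurableSet_Icc]
    have h0 : ∀ᵐ x : ℝ, x ≠ 0 := by simp [ae_iff, measure_singleton]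
    filter_upwards [h0] with x hx0 hx
    have hx' : 0 < x := lt_of_le_of_ne hx.1 (Ne.symm hx0)
    exact mul_nonneg (Real.rpow_nonneg (by linarith [hx.2]) _) (ml_pos_aux hα hα1 hx').le
  have g := Real.Gamma_pos_of_pos hα
  have : 0 ≤ 1 / Real.Gamma α *
    ∫ x in (0:ℝ)..t, (t - x) ^ (α - 1) * mittagLeffler α (-(x ^ α)) := by positivity
  linarith

lemma ml_upper_aux {α : ℝ} (hα : 0 < α) (hα1 : α < 1) :
    ∃ c : ℝ, 0 < c ∧ ∀ t : ℝ, 0 < t → mittagLeffler α (-(t ^ α)) ≤ c * t ^ (-α) := by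
  have hb : 0 < 1 - α := by linarith
  have gb := Real.Gamma_pos_of_pos hb
  have ga := Real.Gamma_pos_of_pos hα
  set c := (2 + 2 / (1 - α)) / Real.Gamma (1 - α) with hcdef
  have hc : 0 < c := by positivity
  have hA : c * Real.Gamma (1 - α) = 2 + 2 / (1 - α) := by rw [hcdef]; field_simp
  refine ⟨c, hc, ?_⟩
  intro t ht
  by_contra hcon
  set h : ℝ → ℝ := fun t => c * t ^ (-α) - mittagLeffler α (-(t ^ α)) with hh
  have hcont : ContinuousOn h (Ioi 0) := by
    apply ContinuousOn.sub
    · apply ContinuousOn.mul continuousOn_const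
      exact ContinuousOn.rpow_const continuousOn_id fun x hx => Or.inl (ne_of_gt hx)
    · exact (mlt_cont hα).continuousOn
  have ha : 0 < (c / 2) ^ (1 / α) := by positivity
  obtain ⟨t0, ht0, hz, hbef⟩ := first_zero hcont ha (by
    intro t h1 h2
    have h3 : t ^ α ≤ c / 2 := by
      have := Real.rpow_le_rpow h1.le h2 hα.le
      rwa [← Real.rpow_mul (by positivity), one_div_mul_cancel hα.ne', Real.rpow_one] at this
    have h4 : 0 < t ^ α := by positivity
    have h5 : 2 ≤ c * t ^ (-α) := by
      rw [Real.rpow_neg h1.le, ← div_eq_mul_inv, le_div_iff₀ h4]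
      linarith
    have := ml_le_one_aux hα hα1 h1
    simp only [hh]
    linarith) ht (by simp only [hh]; linarith)
  have hI : ∀ t : ℝ, 0 < t →
      IntervalIntegrable (fun x => (t - x) ^ (α - 1) * (c * x ^ (-α))) volume 0 t := by
    intro t ht
    have hbeta := beta_conv hα hb ht
    by_contra hni
    have : ¬ IntervalIntegrable (fun x => (t - x) ^ (α - 1) * x ^ (1 - α - 1)) volume 0 t := by
      intro hi
      apply hni
      convert hi.const_mul c using 2 with x
      rw [show 1 - α - 1 = -α by ring]
      ring
    rw [intervalIntegral.integral_undef this] at hbeta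
    rw [show α + (1 - α) = 1 by ring] at hbeta
    simp at hbeta
    rcases hbeta with h | h
    · exact ga.ne' h
    · exact gb.ne' h
  have hV : ∀ t : ℝ, 0 < t → ∫ x in (0:ℝ)..t, (t - x) ^ (α - 1) * (c * x ^ (-α)) =
      c * (Real.Gamma α * Real.Gamma (1 - α)) := by
    intro t ht
    have hbeta := beta_conv hα hb ht
    rw [show α + (1 - α) = 1 by ring, show 1 - α - 1 = -α by ring] at hbeta
    simp at hbeta
    rw [← hbeta, ← intervalIntegral.integral_const_mul]
    congr 1
    ext x
    ring
  have hsub : ∀ t x : ℝ, (t - x) ^ (α - 1) * h x = (t - x) ^ (α - 1) * (c * x ^ (-α)) -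
      (t - x) ^ (α - 1) * mittagLeffler α (-(x ^ α)) := by
    intro t x; simp only [hh]; ring
  have hD1 := Real.hasDerivAt_rpow_const (x := t0) (p := -α) (Or.inl ht0.ne')
  have hD0 := Real.hasDerivAt_rpow_const (x := t0) (p := 1 - α) (Or.inl ht0.ne')
  have hD := hD0.mul ((hD1.const_mul c).add_const (c * Real.Gamma (1 - α) - 1))
  refine volterra_contra hα hα1 (one_div_pos.2 ga) ht0 h
    (fun t => c * t ^ (-α) + (c * Real.Gamma (1 - α) - 1))
    ?_ ?_ hbef hz ?_ hD ?_
  · intro t ht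
    simp_rw [hsub]
    exact (hI t ht).sub (ml_volterra_int hα 0)
  · intro t ht
    simp_rw [hsub]
    rw [intervalIntegral.integral_sub (hI t ht) (ml_volterra_int hα 0), hV t ht]
    have := ml_volterra hα ht
    have e : 1 / Real.Gamma α * (c * (Real.Gamma α * Real.Gamma (1 - α))) =
      c * Real.Gamma (1 - α) := by field_simp
    rw [mul_sub, e]
    simp only [hh]
    linarith
  · obtain ⟨M, hM, h1⟩ := ml_lip_local hα ht0
    obtain ⟨M2, hM2, h2⟩ := lip_of_deriv (hD1.const_mul c)
    refine ⟨M + M2, by positivity, ?_⟩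
    filter_upwards [h1, h2] with t h1 h2
    have e1 := (abs_le.1 h1).1
    have e2 := (abs_le.1 h2).2
    simp only [hh] at hz ⊢
    linarith
  · have v1 := ml_le_one_aux hα hα1 ht0
    have v0 := ml_pos_aux hα hα1 ht0
    simp only [hh] at hz
    have e : t0 ^ (1 - α) * t0 ^ (-α - 1) = t0 ^ (-α) * t0 ^ (-α) := by
      rw [← Real.rpow_add ht0, ← Real.rpow_add ht0]; ring_nf
    have e' : t0 ^ (1 - α - 1) = t0 ^ (-α) := by ring_nf
    rw [e', hA]
    have p : 0 < t0 ^ (-α) := by positivity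
    have : (1 - α) * t0 ^ (-α) * (c * t0 ^ (-α) + (2 + 2 / (1 - α) - 1)) +
        t0 ^ (1 - α) * (c * (-α * t0 ^ (-α - 1))) =
        t0 ^ (-α) * ((1 - 2 * α) * (c * t0 ^ (-α)) + (1 - α) + 2) := by
      have : t0 ^ (1 - α) * (c * (-α * t0 ^ (-α - 1))) =
        c * -α * (t0 ^ (1 - α) * t0 ^ (-α - 1)) := by ring
      rw [this, e]
      have : (1 - α) * (2 / (1 - α)) = 2 := by field_simp
      linear_combination t0 ^ (-α) * this
    rw [this]
    apply mul_pos p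
    nlinarith

lemma ml_bounds {α : ℝ} (hα : 0 < α) (hα1 : α ≤ 1) :
    ∃ c : ℝ, 0 < c ∧ ∀ u : ℝ, 0 < u →
      0 ≤ mittagLeffler α (-u) ∧ mittagLeffler α (-u) ≤ 1 ∧ mittagLeffler α (-u) ≤ c / u := by
  rcases hα1.lt_or_eq with h | rfl
  · obtain ⟨c, hc, hu⟩ := ml_upper_aux hα h
    refine ⟨c, hc, fun u hu0 => ?_⟩
    have ht : 0 < u ^ (1 / α) := by positivity
    have e : (u ^ (1 / α)) ^ α = u := by
      rw [← Real.rpow_mul hu0.le, one_div_mul_cancel hα.ne', Real.rpow_one]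
    have h1 := ml_pos_aux hα h ht
    have h2 := ml_le_one_aux hα h ht
    have h3 := hu _ ht
    rw [Real.rpow_neg ht.le] at h3
    rw [e] at h1 h2 h3
    exact ⟨h1.le, h2, h3⟩
  · refine ⟨1, one_pos, fun u hu => ?_⟩
    rw [ml_one]
    refine ⟨(Real.exp_pos _).le, Real.exp_le_one_iff.2 (by linarith), ?_⟩
    rw [Real.exp_neg, one_div]
    gcongr
    linarith [Real.add_one_le_exp u]

lemma lint_of_int {S : Set ℝ} (hS : MeasurableSet S) {f : ℝ → ℝ} {v : ℝ} (hv : 0 < v)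
    (hf : ∀ x ∈ S, 0 ≤ f x) (h : ∫ x in S, f x = v) :
    ∫⁻ x in S, ENNReal.ofReal (f x) = ENNReal.ofReal v := by
  have hi : Integrable f (volume.restrict S) := by
    by_contra hn
    rw [integral_undef hn] at h
    exact hv.ne h
  rw [← h, ofReal_integral_eq_lintegral_ofReal hi]
  exact (ae_restrict_iff' hS).2 (Eventually.of_forall hf)

lemma int_exp_cos {y : ℝ} (hy : 0 < y) :
    ∫ x in Ioi (0:ℝ), Real.exp (-(x * y)) * (1 - Real.cos x) = 1 / (y * (1 + y ^ 2)) := by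
  have hd : ∀ x ∈ Ici (0:ℝ), HasDerivAt (fun x : ℝ => Real.exp (-(x * y)) *
      (-(1 / y) + (y * Real.cos x - Real.sin x) / (1 + y ^ 2)))
      (Real.exp (-(x * y)) * (1 - Real.cos x)) x := by
    intro x _
    have h1 : HasDerivAt (fun x : ℝ => Real.exp (-(x * y))) (Real.exp (-(x * y)) * (-(1 * y))) x :=
      (((hasDerivAt_id x).mul_const y).neg).exp
    have h2 : HasDerivAt (fun x : ℝ => -(1 / y) + (y * Real.cos x - Real.sin x) / (1 + y ^ 2))
        ((y * (-Real.sin x) - Real.cos x) / (1 + y ^ 2)) x :=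
      ((((Real.hasDerivAt_cos x).const_mul y).sub (Real.hasDerivAt_sin x)).div_const _).const_add _
    refine (h1.mul h2).congr_deriv ?_
    field_simp
    ring
  have hlim : Tendsto (fun x : ℝ => Real.exp (-(x * y)) *
      (-(1 / y) + (y * Real.cos x - Real.sin x) / (1 + y ^ 2))) atTop (nhds 0) := by
    have he : Tendsto (fun x : ℝ => Real.exp (-(x * y))) atTop (nhds 0) :=
      Real.tendsto_exp_neg_atTop_nhds_zero.comp (tendsto_id.atTop_mul_const hy)
    refine he.zero_mul_isBoundedUnder_le ?_
    refine ⟨1 / y + (y + 1) / (1 + y ^ 2), ?_⟩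
    simp only [eventually_map]
    filter_upwards with x
    simp only [Function.comp, Real.norm_eq_abs]
    refine (abs_add_le _ _).trans ?_
    rw [abs_neg, abs_of_pos (by positivity : 0 < 1 / y), abs_div,
      abs_of_pos (by positivity : 0 < 1 + y ^ 2)]
    gcongr
    refine (abs_sub _ _).trans ?_
    rw [abs_mul, abs_of_pos hy]
    have := Real.abs_cos_le_one x
    have := Real.abs_sin_le_one x
    nlinarith
  rw [integral_Ioi_of_hasDerivAt_of_nonneg' hd (fun x _ =>
    mul_nonneg (Real.exp_pos _).le (by linarith [Real.cos_le_one x])) hlim]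
  simp
  field_simp
  ring

lemma cs_lint {s : ℝ} (hs2 : 2 < s) (hs3 : s < 3) :
    ∫⁻ x in Ioi (0:ℝ), ENNReal.ofReal (x ^ (-s) * (1 - Real.cos x)) =
      ENNReal.ofReal (-π / (2 * (Real.Gamma s * Real.cos (s * π / 2)))) := by
  have gs : 0 < Real.Gamma s := Real.Gamma_pos_of_pos (by linarith)
  set b := (s - 1) / 2 with hb
  have hb0 : 0 < b := by rw [hb]; linarith
  have hb1 : 0 < 1 - b := by rw [hb]; linarith
  have gb : 0 < Real.Gamma b := Real.Gamma_pos_of_pos hb0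
  have gb1 : 0 < Real.Gamma (1 - b) := Real.Gamma_pos_of_pos hb1
  have cosn : ∀ x : ℝ, 0 ≤ 1 - Real.cos x := fun x => by linarith [Real.cos_le_one x]
  -- step 1
  have s1 : ∀ x ∈ Ioi (0:ℝ), ENNReal.ofReal (x ^ (-s) * (1 - Real.cos x)) =
      ENNReal.ofReal (1 / Real.Gamma s) * ∫⁻ y in Ioi (0:ℝ),
        ENNReal.ofReal (y ^ (s - 1) * (Real.exp (-(x * y)) * (1 - Real.cos x))) := by
    intro x hx
    have hx : 0 < x := hx
    have h := lint_of_int measurableSet_Ioi (f := fun y => y ^ (s - 1) * Real.exp (-(x * y)))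
      (v := (1 / x) ^ s * Real.Gamma s) (by positivity)
      (fun y hy => mul_nonneg (Real.rpow_nonneg (le_of_lt hy) _) (Real.exp_pos _).le)
      (Real.integral_rpow_mul_exp_neg_mul_Ioi (by linarith) hx)
    have : ∀ y : ℝ, ENNReal.ofReal (y ^ (s - 1) * (Real.exp (-(x * y)) * (1 - Real.cos x))) =
        ENNReal.ofReal (y ^ (s - 1) * Real.exp (-(x * y))) * ENNReal.ofReal (1 - Real.cos x) := by
      intro y
      rw [← ENNReal.ofReal_mul' (cosn x), mul_assoc]
    simp_rw [this]
    rw [lintegral_mul_const _ (by fun_prop), h, ← ENNReal.ofReal_mul' (cosn x),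
      ← ENNReal.ofReal_mul (by positivity)]
    congr 1
    rw [one_div x, Real.inv_rpow hx.le, Real.rpow_neg hx.le]
    field_simp
  rw [setLIntegral_congr_fun measurableSet_Ioi s1, lintegral_const_mul' _ _ ENNReal.ofReal_ne_top,
    lintegral_lintegral_swap (by fun_prop)]
  -- step 2
  have s2 : ∀ y ∈ Ioi (0:ℝ), ∫⁻ x in Ioi (0:ℝ),
        ENNReal.ofReal (y ^ (s - 1) * (Real.exp (-(x * y)) * (1 - Real.cos x))) =
      ∫⁻ w in Ioi (0:ℝ), ENNReal.ofReal (y ^ (s - 2) * Real.exp (-w * y ^ (2:ℝ)) * Real.exp (-w)) := by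
    intro y hy
    have hy : 0 < y := hy
    rw [lint_of_int measurableSet_Ioi (f := fun x => y ^ (s - 1) * (Real.exp (-(x * y)) * (1 - Real.cos x)))
      (v := y ^ (s - 1) * (1 / (y * (1 + y ^ 2)))) (by positivity)
      (fun x _ => mul_nonneg (Real.rpow_nonneg hy.le _) (mul_nonneg (Real.exp_pos _).le (cosn x)))
      (by rw [integral_const_mul, int_exp_cos hy])]
    symm
    apply lint_of_int measurableSet_Ioi (by positivity) (fun w _ => by positivity)
    have : ∀ w : ℝ, y ^ (s - 2) * Real.exp (-w * y ^ (2:ℝ)) * Real.exp (-w) =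
        y ^ (s - 2) * Real.exp (-(1 + y ^ 2) * w) := by
      intro w
      rw [mul_assoc, ← Real.exp_add, Real.rpow_two]
      ring_nf
    simp_rw [this]
    rw [integral_const_mul, integral_exp_mul_Ioi (by nlinarith [sq_nonneg y])]
    rw [show s - 1 = (s - 2) + 1 by ring, Real.rpow_add_one hy.ne']
    rw [mul_zero, Real.exp_zero, neg_div_neg_eq]
    field_simp
  rw [setLIntegral_congr_fun measurableSet_Ioi s2, lintegral_lintegral_swap (by fun_prop)]
  have s3 : ∀ w ∈ Ioi (0:ℝ), ∫⁻ y in Ioi (0:ℝ),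
      ENNReal.ofReal (y ^ (s - 2) * Real.exp (-w * y ^ (2:ℝ)) * Real.exp (-w)) =
      ENNReal.ofReal (w ^ (1 - b - 1) * Real.exp (-(1 * w)) * ((1 / 2) * Real.Gamma b)) := by
    intro w hw
    have hw : 0 < w := hw
    have h := lint_of_int measurableSet_Ioi
      (f := fun y => y ^ (s - 2) * Real.exp (-w * y ^ (2:ℝ)) * Real.exp (-w))
      (v := (w ^ (-b) * (1 / 2) * Real.Gamma b) * Real.exp (-w)) (by positivity)
      (fun y hy => mul_nonneg (mul_nonneg (Real.rpow_nonneg (le_of_lt hy) _) (Real.exp_pos _).le)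
        (Real.exp_pos _).le)
      (by
        rw [integral_mul_const, integral_rpow_mul_exp_neg_mul_rpow two_pos (by linarith) hw]
        rw [show -(s - 2 + 1) / 2 = -b by rw [hb]; ring, show (s - 2 + 1) / 2 = b by rw [hb]; ring])
    rw [h]
    congr 1
    rw [show 1 - b - 1 = -b by ring, one_mul]
    ring
  rw [setLIntegral_congr_fun measurableSet_Ioi s3]
  rw [lint_of_int measurableSet_Ioi
    (f := fun w => w ^ (1 - b - 1) * Real.exp (-(1 * w)) * ((1 / 2) * Real.Gamma b))
    (v := (1 / 1) ^ (1 - b) * Real.Gamma (1 - b) * ((1 / 2) * Real.Gamma b)) (by positivity)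
    (fun w hw => mul_nonneg (mul_nonneg (Real.rpow_nonneg (le_of_lt hw) _) (Real.exp_pos _).le)
        (by positivity))
    (by rw [integral_mul_const, Real.integral_rpow_mul_exp_neg_mul_Ioi hb1 one_pos])]
  rw [← ENNReal.ofReal_mul (by positivity)]
  congr 1
  have hr := Real.Gamma_mul_Gamma_one_sub b
  have hsin : Real.sin (π * b) = -Real.cos (s * π / 2) := by
    rw [hb, show π * ((s - 1) / 2) = s * π / 2 - π / 2 by ring, Real.sin_sub_pi_div_two]
  rw [hsin] at hr
  have : (1 / 1 : ℝ) ^ (1 - b) * Real.Gamma (1 - b) * ((1 / 2) * Real.Gamma b) =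
    (1 / 2) * (Real.Gamma b * Real.Gamma (1 - b)) := by simp; ring
  rw [this, hr]
  have hc : Real.cos (s * π / 2) < 0 := by
    have : 0 < Real.sin (π * b) := Real.sin_pos_of_pos_of_lt_pi (by positivity) (by nlinarith [Real.pi_pos])
    linarith
  have := hc.ne
  field_simp

lemma cs_pos {s : ℝ} (hs2 : 2 < s) (hs3 : s < 3) :
    0 < -π / (Real.Gamma s * Real.cos (s * π / 2)) := by
  have gs : 0 < Real.Gamma s := Real.Gamma_pos_of_pos (by linarith)
  have hc : Real.cos (s * π / 2) < 0 := by
    have : 0 < Real.sin (s * π / 2 - π / 2) :=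
      Real.sin_pos_of_pos_of_lt_pi (by nlinarith [Real.pi_pos]) (by nlinarith [Real.pi_pos])
    rw [Real.sin_sub_pi_div_two] at this
    linarith
  apply div_pos_of_neg_of_neg (by linarith [Real.pi_pos])
  nlinarith

lemma cs_int {s : ℝ} (hs2 : 2 < s) (hs3 : s < 3) :
    2 * ∫ x in Ioi (0:ℝ), x ^ (-s) * (1 - Real.cos x) =
      -π / (Real.Gamma s * Real.cos (s * π / 2)) := by
  have hp := cs_pos hs2 hs3
  rw [integral_eq_lintegral_of_nonneg_ae, cs_lint hs2 hs3, ENNReal.toReal_ofReal]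
  · rw [div_mul_eq_div_div_swap]; ring
  · rw [div_mul_eq_div_div_swap]; positivity
  · refine (ae_restrict_iff' measurableSet_Ioi).2 (Eventually.of_forall fun x hx => ?_)
    exact mul_nonneg (Real.rpow_nonneg (le_of_lt hx) _) (by linarith [Real.cos_le_one x])
  · refine Measurable.aestronglyMeasurable ?_
    fun_prop

/-- dominating function -/
noncomputable def domF (a C b : ℝ) : ℝ → ℝ := fun x => if x ≤ 1 then x ^ a else C * x ^ b

lemma domF_int {a C b : ℝ} (ha : -1 < a) (hb : b < -1) : IntegrableOn (domF a C b) (Ioi 0) := by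
  have : Ioi (0:ℝ) = Ioc 0 1 ∪ Ioi 1 := (Ioc_union_Ioi_eq_Ioi zero_le_one).symm
  rw [this]
  apply IntegrableOn.union
  · have h := (intervalIntegrable_iff_integrableOn_Ioc_of_le zero_le_one).1
      (intervalIntegral.intervalIntegrable_rpow' (a := 0) (b := 1) ha)
    refine h.congr_fun (fun x hx => ?_) measurableSet_Ioc
    simp [domF, hx.2]
  · have h := (integrableOn_Ioi_rpow_of_lt hb one_pos).const_mul C
    refine IntegrableOn.congr_fun h (fun x hx => ?_) measurableSet_Ioi
    have : ¬ x ≤ 1 := not_le.2 hx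
    simp [domF, this]

noncomputable def phiF (s x : ℝ) : ℝ := x ^ (-s) * (1 - Real.cos x)

lemma phiF_nonneg {s x : ℝ} (hx : 0 ≤ x) : 0 ≤ phiF s x :=
  mul_nonneg (Real.rpow_nonneg hx _) (by linarith [Real.cos_le_one x])

lemma phiF_le {s x y : ℝ} (hs2 : 2 < s) (hx : 0 < x) (hxy : x ≤ y) :
    phiF s y ≤ domF (2 - s) 2 (-s) x := by
  have hy : 0 < y := hx.trans_le hxy
  unfold domF phiF
  split_ifs with h
  · have h1 : 1 - Real.cos y ≤ y ^ (2:ℝ) := by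
      rw [Real.rpow_two]
      nlinarith [Real.one_sub_sq_div_two_le_cos (x := y), sq_nonneg y]
    calc y ^ (-s) * (1 - Real.cos y) ≤ y ^ (-s) * y ^ (2:ℝ) := by gcongr
      _ = y ^ (2 - s) := by rw [← Real.rpow_add hy]; ring_nf
      _ ≤ x ^ (2 - s) := Real.rpow_le_rpow_of_nonpos hx hxy (by linarith)
  · have h1 : 1 - Real.cos y ≤ 2 := by linarith [Real.neg_one_le_cos y]
    rw [mul_comm]
    have h2 : y ^ (-s) ≤ x ^ (-s) := Real.rpow_le_rpow_of_nonpos hx hxy (by linarith)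
    have : 0 ≤ y ^ (-s) := by positivity
    exact mul_le_mul h1 h2 this (by norm_num)

lemma phi_ceil_le {k x : ℝ} (hk : 0 < k) : x ≤ k * ⌈x / k⌉₊ := by
  have := Nat.le_ceil (x / k)
  rw [div_le_iff₀ hk] at this
  linarith

lemma phiF_step_int {s k : ℝ} (hs2 : 2 < s) (hs3 : s < 3) (hk : 0 < k) :
    IntegrableOn (fun x => phiF s (k * ⌈x / k⌉₊)) (Ioi 0) := by
  refine Integrable.mono' (domF_int (a := 2 - s) (C := 2) (b := -s) (by linarith) (by linarith)) ?_ ?_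
  · refine Measurable.aestronglyMeasurable ?_
    unfold phiF
    fun_prop
  · refine (ae_restrict_iff' measurableSet_Ioi).2 (Eventually.of_forall fun x hx => ?_)
    have hx : 0 < x := hx
    rw [Real.norm_of_nonneg (phiF_nonneg (hx.le.trans (phi_ceil_le hk)))]
    exact phiF_le hs2 hx (phi_ceil_le hk)

lemma ls_eq_int {s k : ℝ} (hs2 : 2 < s) (hs3 : s < 3) (hk : 0 < k) :
    lsFun s k = k ^ (s - 1) * (2 * ∫ x in Ioi (0:ℝ), phiF s (k * ⌈x / k⌉₊)) := by
  have hmono : Monotone (fun n : ℕ => k * (n:ℝ)) := by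
    intro a b hab
    simp only []
    gcongr
  have hU : ⋃ n : ℕ, Ioc (k * (n:ℝ)) (k * ((Order.succ n : ℕ) : ℝ)) = Ioi 0 := by
    have := iUnion_Ioc_map_succ_eq_Ioi (f := fun n : ℕ => k * (n:ℝ)) (fun a => hmono bot_le) (by
      rintro ⟨B, hB⟩
      obtain ⟨n, hn⟩ := exists_nat_gt (B / k)
      have := hB ⟨n, rfl⟩
      rw [div_lt_iff₀ hk] at hn
      simp only [] at this
      linarith)
    rw [this]; simp
  have hI := phiF_step_int hs2 hs3 hk
  rw [← hU] at hI
  have hs := integral_iUnion (μ := volume) (fun n : ℕ => measurableSet_Ioc) hmono.pairwise_disjoint_on_Ioc_succ hI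
  rw [hU] at hs
  have hterm : ∀ n : ℕ, ∫ x in Ioc (k * (n:ℝ)) (k * ((Order.succ n : ℕ) : ℝ)), phiF s (k * ⌈x / k⌉₊)
      = k ^ (1 - s) * (((n + 1 : ℕ) : ℝ) ^ (-s) * (1 - Real.cos ((n + 1 : ℕ) * k))) := by
    intro n
    have e : ∀ x ∈ Ioc (k * (n:ℝ)) (k * ((Order.succ n : ℕ) : ℝ)), phiF s (k * ⌈x / k⌉₊) =
        phiF s (k * (n + 1 : ℕ)) := by
      intro x hx
      have : ⌈x / k⌉₊ = n + 1 := by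
        rw [Nat.ceil_eq_iff (by omega)]
        constructor
        · rw [lt_div_iff₀ hk]
          have := hx.1
          simp
          linarith
        · rw [div_le_iff₀ hk]
          have := hx.2
          simp only [Order.succ_eq_add_one] at this
          linarith
      rw [this]
    rw [setIntegral_congr_fun measurableSet_Ioc e, setIntegral_const]
    rw [Real.volume_real_Ioc_of_le (by gcongr; exact Order.le_succ n)]
    simp only [Order.succ_eq_add_one, smul_eq_mul, phiF]
    rw [Real.mul_rpow hk.le (by positivity), mul_comm k ((n + 1 : ℕ) : ℝ),
      show (1 - s) = 1 + (-s) by ring, Real.rpow_add hk, Real.rpow_one]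
    push_cast
    ring
  simp_rw [hterm] at hs
  rw [tsum_mul_left] at hs
  rw [hs, lsFun]
  have hp : ∑' d : ℕ+, (d : ℝ) ^ (-s) * (1 - Real.cos (d * k)) =
      ∑' n : ℕ, (((n + 1 : ℕ) : ℝ) ^ (-s) * (1 - Real.cos ((n + 1 : ℕ) * k))) :=
    tsum_pnat_eq_tsum_succ (f := fun n : ℕ => (n : ℝ) ^ (-s) * (1 - Real.cos (n * k)))
  rw [hp]
  have : k ^ (s - 1) * k ^ (1 - s) = 1 := by
    rw [← Real.rpow_add hk]; simp
  linear_combination (- 2 * ∑' n : ℕ, (((n + 1 : ℕ) : ℝ) ^ (-s) * (1 - Real.cos ((n + 1 : ℕ) * k)))) * this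

lemma ls_asymp {s : ℝ} (hs2 : 2 < s) (hs3 : s < 3) :
    Tendsto (fun k => lsFun s k / k ^ (s - 1)) (nhdsWithin 0 (Ioi 0))
      (nhds (-π / (Real.Gamma s * Real.cos (s * π / 2)))) := by
  rw [← cs_int hs2 hs3]
  have h : Tendsto (fun k : ℝ => ∫ x in Ioi (0:ℝ), phiF s (k * ⌈x / k⌉₊)) (nhdsWithin 0 (Ioi 0))
      (nhds (∫ x in Ioi (0:ℝ), phiF s x)) := by
    apply tendsto_integral_filter_of_dominated_convergence (domF (2 - s) 2 (-s))
    · filter_upwards [self_mem_nhdsWithin] with k hk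
      exact (phiF_step_int hs2 hs3 hk).aestronglyMeasurable
    · filter_upwards [self_mem_nhdsWithin] with k hk
      refine (ae_restrict_iff' measurableSet_Ioi).2 (Eventually.of_forall fun x hx => ?_)
      have hx : 0 < x := hx
      rw [Real.norm_of_nonneg (phiF_nonneg (hx.le.trans (phi_ceil_le hk)))]
      exact phiF_le hs2 hx (phi_ceil_le hk)
    · exact domF_int (by linarith) (by linarith)
    · refine (ae_restrict_iff' measurableSet_Ioi).2 (Eventually.of_forall fun x hx => ?_)
      have hx : 0 < x := hx
      have hc : ContinuousAt (phiF s) x := by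
        unfold phiF
        apply ContinuousAt.mul
        · exact continuousAt_id.rpow_const (Or.inl hx.ne')
        · fun_prop
      refine hc.tendsto.comp ?_
      have hu : Tendsto (fun k : ℝ => x + k) (nhdsWithin 0 (Ioi 0)) (nhds x) := by
        have : Continuous (fun k : ℝ => x + k) := by fun_prop
        have h2 := this.tendsto 0
        rw [add_zero] at h2
        exact h2.mono_left nhdsWithin_le_nhds
      refine tendsto_of_tendsto_of_tendsto_of_le_of_le' tendsto_const_nhds hu ?_ ?_
      · filter_upwards [self_mem_nhdsWithin] with k hk
        exact phi_ceil_le hk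
      · filter_upwards [self_mem_nhdsWithin] with k hk
        have hk : 0 < k := hk
        have := (Nat.ceil_lt_add_one (div_nonneg hx.le hk.le)).le
        calc k * (⌈x / k⌉₊ : ℝ) ≤ k * (x / k + 1) := by gcongr
          _ = x + k := by field_simp
  refine (h.const_mul 2).congr' ?_
  filter_upwards [self_mem_nhdsWithin] with k hk
  have hk : 0 < k := hk
  rw [ls_eq_int hs2 hs3 hk]
  have : 0 < k ^ (s - 1) := by positivity
  field_simp

lemma ls_summand {s : ℝ} (hs2 : 2 < s) : Summable (fun d : ℕ+ => 2 * (d : ℝ) ^ (-s)) := by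
  apply Summable.mul_left
  have h : Summable (fun n : ℕ => (n : ℝ) ^ (-s)) := Real.summable_nat_rpow.2 (by linarith)
  exact h.comp_injective PNat.coe_injective

lemma ls_term_bound (s k : ℝ) (d : ℕ+) :
    ‖(d : ℝ) ^ (-s) * (1 - Real.cos (d * k))‖ ≤ 2 * (d : ℝ) ^ (-s) := by
  have h0 : 0 ≤ (d : ℝ) ^ (-s) := by positivity
  rw [Real.norm_of_nonneg (mul_nonneg h0 (by linarith [Real.cos_le_one (d * k)]))]
  nlinarith [Real.neg_one_le_cos (d * k)]

lemma ls_cont {s : ℝ} (hs2 : 2 < s) : Continuous (lsFun s) := by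
  unfold lsFun
  apply Continuous.mul continuous_const
  refine continuous_tsum (fun d => by fun_prop) (ls_summand hs2) (fun d k => ls_term_bound s k d)

lemma ls_even (s k : ℝ) : lsFun s (-k) = lsFun s k := by
  unfold lsFun
  simp

lemma ls_ge {s : ℝ} (hs2 : 2 < s) (k : ℝ) : 2 * (1 - Real.cos k) ≤ lsFun s k := by
  unfold lsFun
  have h := (Summable.of_norm_bounded (ls_summand hs2) (fun d => ls_term_bound s k d)).le_tsum 1
    (fun d _ => mul_nonneg (by positivity) (by linarith [Real.cos_le_one (d * k)]))
  simp at h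
  linarith

lemma ls_lower {s : ℝ} (hs2 : 2 < s) (hs3 : s < 3) :
    ∃ c : ℝ, 0 < c ∧ ∀ k : ℝ, 0 < k → k ≤ π → c * k ^ (s - 1) ≤ lsFun s k := by
  have hp := cs_pos hs2 hs3
  set cs := -π / (Real.Gamma s * Real.cos (s * π / 2)) with hcs
  have hev := (ls_asymp hs2 hs3).eventually_const_lt (show cs / 2 < cs by linarith)
  obtain ⟨δ, hδ, hsub⟩ := (mem_nhdsGT_iff_exists_Ioo_subset).1 hev
  have hδ : 0 < δ := hδ
  have hδp : 0 < 4 / π ^ 2 * δ ^ (3 - s) := by positivity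
  refine ⟨min (cs / 2) (4 / π ^ 2 * δ ^ (3 - s)), lt_min (by linarith) hδp, ?_⟩
  intro k hk hkp
  have kp : 0 < k ^ (s - 1) := by positivity
  rcases lt_or_ge k δ with h | h
  · have := hsub (show k ∈ Ioo 0 δ from ⟨hk, h⟩)
    simp only [mem_ofPred_eq] at this
    rw [lt_div_iff₀ kp] at this
    refine le_trans ?_ this.le
    gcongr
    exact min_le_left _ _
  · have h1 := ls_ge hs2 k
    have h2 : Real.cos k ≤ 1 - 2 / π ^ 2 * k ^ 2 :=
      Real.cos_le_one_sub_mul_cos_sq (by rw [abs_of_pos hk]; exact hkp)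
    have h3 : δ ^ (3 - s) ≤ k ^ (3 - s) := Real.rpow_le_rpow hδ.le h (by linarith)
    have h4 : k ^ (3 - s) * k ^ (s - 1) = k ^ 2 := by
      rw [← Real.rpow_add hk, ← Real.rpow_two]; ring_nf
    calc _ ≤ 4 / π ^ 2 * δ ^ (3 - s) * k ^ (s - 1) := by gcongr; exact min_le_right _ _
      _ ≤ 4 / π ^ 2 * k ^ (3 - s) * k ^ (s - 1) := by gcongr
      _ = 4 / π ^ 2 * k ^ 2 := by rw [mul_assoc, h4]
      _ = 2 * (2 / π ^ 2 * k ^ 2) := by ring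
      _ ≤ _ := by linarith

lemma main_int {s α : ℝ} (hs2 : 2 < s) (hα : 0 < α) (hα1 : α ≤ 1) :
    IntegrableOn
      (fun u : ℝ => u ^ ((2 - s) / (s - 1)) * mittagLeffler α (-u)) (Ioi 0) := by
  obtain ⟨c, hc, hb⟩ := ml_bounds hα hα1
  have hs1 : 0 < s - 1 := by linarith
  have hq1 : -1 < (2 - s) / (s - 1) := by rw [lt_div_iff₀ hs1]; linarith
  have hq2 : (2 - s) / (s - 1) < 0 := div_neg_of_neg_of_pos (by linarith) hs1
  refine Integrable.mono' (domF_int (a := (2 - s) / (s - 1)) (C := c) (b := (2 - s) / (s - 1) - 1)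
    hq1 (by linarith)) ?_ ?_
  · have := (ml_continuous hα).measurable
    refine Measurable.aestronglyMeasurable ?_
    fun_prop
  · refine (ae_restrict_iff' measurableSet_Ioi).2 (Eventually.of_forall fun x hx => ?_)
    have hx : 0 < x := hx
    obtain ⟨h1, h2, h3⟩ := hb x hx
    have hp : 0 < x ^ ((2 - s) / (s - 1)) := by positivity
    rw [Real.norm_of_nonneg (mul_nonneg hp.le h1)]
    unfold domF
    split_ifs with h
    · nlinarith
    · rw [Real.rpow_sub_one hx.ne']
      calc _ ≤ x ^ ((2 - s) / (s - 1)) * (c / x) := by gcongr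
        _ = _ := by ring

lemma main_change {s α c : ℝ} (hs2 : 2 < s) (hc : 0 < c) :
    ∫ x in Ioi (0:ℝ), mittagLeffler α (-(c * x ^ (s - 1))) =
      (1 / (s - 1)) * c ^ (-(1:ℝ) / (s - 1)) *
        ∫ u in Ioi (0:ℝ), u ^ ((2 - s) / (s - 1)) * mittagLeffler α (-u) := by
  have hs1 : 0 < s - 1 := by linarith
  have hp : 0 < 1 / (s - 1) := by positivity
  rw [← integral_comp_rpow_Ioi_of_pos (g := fun x => mittagLeffler α (-(c * x ^ (s - 1)))) hp]
  have hsc := integral_comp_mul_left_Ioi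
    (fun u => u ^ ((2 - s) / (s - 1)) * mittagLeffler α (-u)) 0 hc
  rw [mul_zero, smul_eq_mul] at hsc
  have hJ : ∫ u in Ioi (0:ℝ), u ^ ((2 - s) / (s - 1)) * mittagLeffler α (-u) =
    c * ∫ x in Ioi (0:ℝ), (c * x) ^ ((2 - s) / (s - 1)) * mittagLeffler α (-(c * x)) := by
    rw [hsc]; field_simp
  rw [hJ, ← integral_const_mul, ← integral_const_mul]
  apply setIntegral_congr_fun measurableSet_Ioi
  intro x hx
  have hx : 0 < x := hx
  simp only [smul_eq_mul]
  rw [← Real.rpow_mul hx.le, one_div_mul_cancel hs1.ne', Real.rpow_one,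
    Real.mul_rpow hc.le hx.le]
  have e1 : 1 / (s - 1) - 1 = (2 - s) / (s - 1) := by field_simp; ring
  have e2 : c ^ (-(1:ℝ) / (s - 1)) * (c * c ^ ((2 - s) / (s - 1))) = 1 := by
    rw [mul_comm c, ← Real.rpow_add_one hc.ne', ← Real.rpow_add hc]
    rw [show -(1:ℝ) / (s - 1) + ((2 - s) / (s - 1) + 1) = 0 by field_simp; ring, Real.rpow_zero]
  rw [e1]
  linear_combination (-(1 / (s - 1) * x ^ ((2 - s) / (s - 1)) * mittagLeffler α (-(c * x)))) * e2

lemma main_dct {s α : ℝ} (hs2 : 2 < s) (hs3 : s < 3) (hα : 0 < α) (hα1 : α ≤ 1) :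
    Tendsto (fun T : ℝ => ∫ x in Ioi (0:ℝ), (Iic (π * T)).indicator
        (fun x => mittagLeffler α (-(T ^ (s - 1) * lsFun s (x / T)))) x) atTop
      (nhds (∫ x in Ioi (0:ℝ), mittagLeffler α
        (-((-π / (Real.Gamma s * Real.cos (s * π / 2))) * x ^ (s - 1))))) := by
  obtain ⟨C, hC, hb⟩ := ml_bounds hα hα1
  obtain ⟨c, hc, hl⟩ := ls_lower hs2 hs3
  apply tendsto_integral_filter_of_dominated_convergence (domF 0 (C / c) (-(s - 1)))
  · filter_upwards with T
    have h1 := (ml_continuous hα).measurable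
    have h2 := (ls_cont hs2).measurable
    refine Measurable.aestronglyMeasurable ?_
    refine Measurable.indicator ?_ measurableSet_Iic
    fun_prop
  · filter_upwards [eventually_gt_atTop 0] with T hT
    refine (ae_restrict_iff' measurableSet_Ioi).2 (Eventually.of_forall fun x hx => ?_)
    have hx : 0 < x := hx
    have hd : 0 ≤ domF 0 (C / c) (-(s - 1)) x := by
      unfold domF; split_ifs <;> positivity
    by_cases hxT : x ∈ Iic (π * T)
    · rw [indicator_of_mem hxT]
      have hl' := hl (x / T) (by positivity) ((div_le_iff₀ hT).2 hxT)
      have hTp : 0 < T ^ (s - 1) := by positivity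
      have hxp : 0 < x ^ (s - 1) := by positivity
      have hge : c * x ^ (s - 1) ≤ T ^ (s - 1) * lsFun s (x / T) := by
        rw [Real.div_rpow hx.le hT.le] at hl'
        calc c * x ^ (s - 1) = T ^ (s - 1) * (c * (x ^ (s - 1) / T ^ (s - 1))) := by field_simp
          _ ≤ _ := by gcongr
      have hpos : 0 < c * x ^ (s - 1) := by positivity
      obtain ⟨h1, h2, h3⟩ := hb _ (hpos.trans_le hge)
      rw [Real.norm_of_nonneg h1]
      unfold domF
      split_ifs with h
      · rw [Real.rpow_zero]; exact h2
      · refine h3.trans ?_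
        calc C / (T ^ (s - 1) * lsFun s (x / T)) ≤ C / (c * x ^ (s - 1)) := by gcongr
          _ = _ := by rw [Real.rpow_neg hx.le]; field_simp
    · rw [indicator_of_notMem hxT, norm_zero]
      exact hd
  · exact domF_int (by norm_num) (by linarith)
  · refine (ae_restrict_iff' measurableSet_Ioi).2 (Eventually.of_forall fun x hx => ?_)
    have hx : 0 < x := hx
    have h0 : Tendsto (fun T : ℝ => x / T) atTop (nhdsWithin 0 (Ioi 0)) := by
      rw [tendsto_nhdsWithin_iff]
      refine ⟨tendsto_const_nhds.div_atTop tendsto_id, ?_⟩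
      filter_upwards [eventually_gt_atTop 0] with T hT
      exact div_pos hx hT
    have h1 := ((ls_asymp hs2 hs3).comp h0).mul_const (x ^ (s - 1))
    have h2 := (((ml_continuous hα).tendsto _).comp h1.neg)
    refine h2.congr' ?_
    filter_upwards [eventually_gt_atTop 0, eventually_ge_atTop (x / π)] with T hT hxT
    have hmem : x ∈ Iic (π * T) := by
      rw [div_le_iff₀ Real.pi_pos] at hxT
      simp only [mem_Iic]; linarith
    rw [indicator_of_mem hmem]
    simp only [Function.comp]
    congr 2
    rw [Real.div_rpow hx.le hT.le]
    have hTp : 0 < T ^ (s - 1) := by positivity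
    have hxp : 0 < x ^ (s - 1) := by positivity
    field_simp

theorem GDE_max_decay_superdiffusive_range
    (s α : ℝ) (hs2 : 2 < s) (hs3 : s < 3) (hα : 0 < α) (hα1 : α ≤ 1) :
    IntegrableOn
      (fun u : ℝ => u ^ ((2 - s) / (s - 1)) * mittagLeffler α (-u)) (Ioi 0) ∧
    Tendsto
      (fun t : ℝ => t ^ (α / (s - 1)) *
        ((1 / (2 * π)) * ∫ k in (-π)..π, mittagLeffler α (-(t ^ α) * lsFun s k)))
      atTop
      (nhds ((1 / (π * (s - 1))) *
        (-π / (Real.Gamma s * Real.cos (s * π / 2))) ^ (-(1 : ℝ) / (s - 1)) *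
        ∫ u in Ioi (0:ℝ), u ^ ((2 - s) / (s - 1)) * mittagLeffler α (-u))) := by
  refine ⟨main_int hs2 hα hα1, ?_⟩
  have hs1 : 0 < s - 1 := by linarith
  have hT : Tendsto (fun t : ℝ => t ^ (α / (s - 1))) atTop atTop :=
    tendsto_rpow_atTop (by positivity)
  have h := ((main_dct hs2 hs3 hα hα1).comp hT).const_mul (1 / π)
  rw [main_change hs2 (cs_pos hs2 hs3)] at h
  have e : ∀ c J : ℝ, 1 / π * (1 / (s - 1) * c * J) = 1 / (π * (s - 1)) * c * J := by
    intro c J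
    have := Real.pi_pos
    field_simp
  rw [e] at h
  refine h.congr' ?_
  filter_upwards [eventually_gt_atTop 0] with t ht
  simp only [Function.comp]
  have hTp : 0 < t ^ (α / (s - 1)) := by positivity
  have hTs : (t ^ (α / (s - 1))) ^ (s - 1) = t ^ α := by
    rw [← Real.rpow_mul ht.le, div_mul_cancel₀ _ hs1.ne']
  rw [hTs]
  set T := t ^ (α / (s - 1)) with hTdef
  set G : ℝ → ℝ := fun k => mittagLeffler α (-(t ^ α) * lsFun s k) with hG
  have hGc : Continuous G := (ml_continuous hα).comp (continuous_const.mul (ls_cont hs2))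
  have hGe : ∀ k, G (-k) = G k := fun k => by simp only [hG, ls_even]
  have hpi := Real.pi_pos
  have e1 : ∫ k in (-π)..π, G k = 2 * ∫ k in (0:ℝ)..π, G k := by
    rw [← intervalIntegral.integral_add_adjacent_intervals (hGc.intervalIntegrable (-π) 0)
      (hGc.intervalIntegrable 0 π)]
    have : ∫ k in (-π)..0, G k = ∫ k in (0:ℝ)..π, G k := by
      have h2 := intervalIntegral.integral_comp_neg (a := 0) (b := π) G
      simp only [hGe, neg_zero] at h2
      exact h2.symm
    rw [this]; ring
  have e2 : ∫ x in Ioi (0:ℝ), (Iic (π * T)).indicator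
      (fun x => mittagLeffler α (-(t ^ α * lsFun s (x / T)))) x = T * ∫ k in (0:ℝ)..π, G k := by
    rw [setIntegral_indicator measurableSet_Iic, Ioi_inter_Iic,
      ← intervalIntegral.integral_of_le (by positivity)]
    have h3 := intervalIntegral.integral_comp_div (a := 0) (b := π * T) G hTp.ne'
    rw [zero_div, mul_div_cancel_right₀ _ hTp.ne', smul_eq_mul] at h3
    rw [← h3]
    simp only [hG, neg_mul]
  rw [e2, e1]
  field_simp
end

section
/- Let 0 < α ≤ 1, 1 < β ≤ 2 and c > 0, and let h : ℤ → ℂ be absolutely summable with Fourier series ĥ(k) = ∑_{n ∈ ℤ} h(n) e^{i k n}. Then for every m ∈ ℤ, lim_{t → ∞} t^{α/β} · (1/2π) ∫_{-π}^{π} e^{-i k m} E_α(-c t^α |k|^β) · ĥ(k) dk = (1/(πβ)) · c^{-1/β} · I₀(α,β) · ∑_{n ∈ ℤ} h(n), where I₀(α,β) = ∫_0^∞ u^{(1-β)/β} E_α(-u) du. In particular, for the stepwise time-dependent generalized diffusion equation the asymptotic decay exponent t^{-α/β} depends only on the operator acting after the switching time and not on the intermediate state h reached at the switching time. -/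
open Real Filter MeasureTheory Set

/-- Fourier series `ĥ(k) = ∑_{n ∈ ℤ} h(n) e^{ikn}` of a summable `h : ℤ → ℂ`. -/
noncomputable def fourierZ (h : ℤ → ℂ) (k : ℝ) : ℂ :=
  ∑' n : ℤ, h n * Complex.exp (Complex.I * k * n)

namespace GDE

noncomputable def bc (r : ℝ) (n : ℕ) : ℝ := (-1) ^ n * Ring.choose r n

noncomputable def Bs (r : ℝ) : PowerSeries ℝ := PowerSeries.mk (bc r)

lemma bc_zero (r : ℝ) : bc r 0 = 1 := by simp [bc]

lemma choose_rec (r : ℝ) (n : ℕ) : Ring.choose r (n+1) * (n+1) = Ring.choose r n * (r - n) := by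
  have h := Ring.choose_smul_choose r (Nat.le_succ n)
  have e : Ring.choose (r - n) (n.succ - n) = r - n := by
    simp
  rw [e] at h
  rw [← h]
  simp
  ring

lemma bc_succ (r : ℝ) (n : ℕ) : bc r (n+1) = bc r n * ((n - r) / (n+1)) := by
  have h := choose_rec r n
  have h0 : (n:ℝ) + 1 ≠ 0 := by positivity
  have : Ring.choose r (n+1) = Ring.choose r n * (r - n) / (n+1) := by
    field_simp; linarith
  rw [bc, bc, this, pow_succ]
  field_simp
  ring

lemma Bs_eq (r : ℝ) : Bs r = PowerSeries.rescale (-1) (PowerSeries.binomialSeries ℝ r) := by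
  ext n
  simp [Bs, bc, PowerSeries.coeff_rescale]

lemma Bs_add (r s : ℝ) : Bs (r + s) = Bs r * Bs s := by
  simp [Bs_eq]

lemma Bs_zero : Bs 0 = 1 := by simp [Bs_eq]

lemma Bs_one : Bs 1 = 1 - PowerSeries.X := by
  have := PowerSeries.binomialSeries_nat (R := ℝ) (A := ℝ) 1
  simp only [Nat.cast_one] at this
  rw [Bs_eq, this]
  simp
  ring

lemma bc_nonneg {r : ℝ} (hr : r ≤ 0) (n : ℕ) : 0 ≤ bc r n := by
  induction n with
  | zero => simp [bc_zero]
  | succ n ih =>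
    rw [bc_succ]
    have : 0 ≤ (n:ℝ) - r := by have : (0:ℝ) ≤ n := by positivity
                               linarith
    positivity

lemma bc_nonpos {r : ℝ} (hr : 0 ≤ r) (hr1 : r ≤ 1) (n : ℕ) : bc r (n+1) ≤ 0 := by
  induction n with
  | zero => simp [bc_succ, bc_zero, hr]
  | succ n ih =>
    rw [bc_succ]
    apply mul_nonpos_of_nonpos_of_nonneg ih
    have : 0 ≤ ((n+1 : ℕ):ℝ) - r := by
      push_cast
      have : (0:ℝ) ≤ n := by positivity
      linarith
    positivity

noncomputable def A (s : ℝ) (n : ℕ) : ℝ := bc (-1 - s) n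

lemma A_zero (s : ℝ) : A s 0 = 1 := bc_zero _

lemma A_succ (s : ℝ) (n : ℕ) : A s (n+1) = A s n * (1 + s / (n+1)) := by
  rw [A, A, bc_succ]
  have h0 : (n:ℝ) + 1 ≠ 0 := by positivity
  congr 1
  field_simp
  ring

lemma A_pos {s : ℝ} (hs : 0 ≤ s) (n : ℕ) : 0 < A s n := by
  induction n with
  | zero => simp [A_zero]
  | succ n ih => rw [A_succ]; positivity

lemma A_le_pow {s : ℝ} (hs : 0 ≤ s) (n : ℕ) : A s n ≤ (1 + s) ^ n := by
  induction n with
  | zero => simp [A_zero]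
  | succ n ih =>
    rw [A_succ, pow_succ]
    have : s / (n+1) ≤ s := div_le_self hs (by linarith [(Nat.cast_nonneg n : (0:ℝ) ≤ n)])
    have := (A_pos hs n).le
    gcongr

lemma A_le {s : ℝ} (hs : 0 ≤ s) {M n : ℕ} (hM : 1 ≤ M) (hn : M ≤ n) :
    A s n ≤ (1 + s) ^ M * ((n:ℝ) / M) ^ s := by
  induction n, hn using Nat.le_induction with
  | base =>
    have : (M:ℝ) ≠ 0 := by positivity
    rw [div_self this]; simpa using A_le_pow hs M
  | succ n hn ih =>
    have hn0 : (0:ℝ) < n := by exact_mod_cast (by omega : 0 < n)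
    have hM0 : (0:ℝ) < M := by exact_mod_cast hM
    rw [A_succ]
    have h1 : 1 + s / ((n:ℝ)+1) ≤ (((n:ℝ)+1)/n) ^ s := by
      have hl := Real.one_sub_inv_le_log_of_pos (show 0 < ((n:ℝ)+1)/n by positivity)
      rw [Real.rpow_def_of_pos (by positivity)]
      have e : 1 - (((n:ℝ)+1)/n)⁻¹ = 1/((n:ℝ)+1) := by field_simp; ring
      rw [e] at hl
      have h2 := Real.add_one_le_exp (Real.log (((n:ℝ)+1)/n) * s)
      have h3 : s / ((n:ℝ)+1) ≤ Real.log (((n:ℝ)+1)/n) * s := by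
        calc s / ((n:ℝ)+1) = 1/((n:ℝ)+1) * s := by ring
          _ ≤ _ := by gcongr
      linarith
    calc A s n * (1 + s / ((n:ℝ)+1)) ≤ ((1 + s) ^ M * ((n:ℝ) / M) ^ s) * (((n:ℝ)+1)/n) ^ s := by
          gcongr
      _ = (1 + s) ^ M * (((n+1:ℕ):ℝ) / M) ^ s := by
          rw [mul_assoc, ← Real.mul_rpow (by positivity) (by positivity)]
          congr 2
          push_cast
          field_simp

lemma A_eq_Gamma {s : ℝ} (hs : 0 < s) {n : ℕ} (hn : 0 < n) :
    A s n * (n:ℝ) ^ (-s) = (s * Real.GammaSeq s n)⁻¹ := by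
  have key : ∀ n : ℕ, A s n * (s * n.factorial) = ∏ j ∈ Finset.range (n+1), (s + j) := by
    intro n
    induction n with
    | zero => simp [A_zero]
    | succ n ih =>
      rw [Finset.prod_range_succ, ← ih, A_succ, Nat.factorial_succ]
      have h0 : (n:ℝ) + 1 ≠ 0 := by positivity
      push_cast
      field_simp
      ring
  have hn0 : (0:ℝ) < n := by exact_mod_cast hn
  rw [Real.GammaSeq, ← key, Real.rpow_neg hn0.le]
  have : (n.factorial : ℝ) ≠ 0 := by positivity
  have : (n:ℝ) ^ s ≠ 0 := by positivity
  have := (A_pos hs.le n).ne'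
  field_simp

lemma A_tendsto {s : ℝ} (hs : 0 ≤ s) :
    Tendsto (fun n : ℕ => A s n * (n:ℝ) ^ (-s)) atTop (nhds (Real.Gamma (s + 1))⁻¹) := by
  rcases hs.eq_or_lt with rfl | hs
  · have : ∀ n, A 0 n = 1 := by
      intro n
      induction n with
      | zero => simp [A_zero]
      | succ n ih => simp [A_succ, ih]
    simp [this]
  · rw [Real.Gamma_add_one hs.ne']
    have h := ((Real.GammaSeq_tendsto_Gamma s).const_mul s).inv₀
      (mul_ne_zero hs.ne' (Real.Gamma_pos_of_pos hs).ne')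
    refine h.congr' ?_
    filter_upwards [eventually_gt_atTop 0] with n hn
    exact (A_eq_Gamma hs hn).symm

lemma A_le' {s : ℝ} (hs : 0 ≤ s) {M n : ℕ} (hM : 1 ≤ M) (hn : M ≤ n) :
    A s n * (n:ℝ) ^ (-s) ≤ (1 + s) ^ M * (M:ℝ) ^ (-s) := by
  have hn0 : (0:ℝ) < n := by exact_mod_cast (by omega : 0 < n)
  have hM0 : (0:ℝ) < M := by exact_mod_cast hM
  calc _ ≤ ((1 + s) ^ M * ((n:ℝ) / M) ^ s) * (n:ℝ) ^ (-s) := by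
        gcongr; exact A_le hs hM hn
    _ = _ := by
        rw [Real.div_rpow hn0.le hM0.le, Real.rpow_neg hn0.le, Real.rpow_neg hM0.le]
        have : (n:ℝ) ^ s ≠ 0 := by positivity
        field_simp

lemma summable_poly (α : ℝ) (M : ℕ) {q : ℝ} (hq0 : 0 ≤ q) (hq : q < 1) (hα : 0 ≤ α) (hα1 : α ≤ 1) :
    Summable (fun j : ℕ => (1 + α * j) ^ M * q ^ j) := by
  have h := summable_pow_mul_geometric_of_norm_lt_one (R := ℝ) M (r := q)
    (by rwa [Real.norm_of_nonneg hq0])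
  have h2 := summable_geometric_of_lt_one hq0 hq
  have h3 := (h.add h2).mul_left ((2:ℝ)^M)
  refine Summable.of_nonneg_of_le (fun j => by positivity) (fun j => ?_) h3
  rcases Nat.eq_zero_or_pos j with rfl | hj
  · simp
    have : (1:ℝ) ≤ 2 ^ M := one_le_pow₀ (by norm_num)
    have h0 : (0:ℝ) ≤ 0 ^ M := by positivity
    nlinarith
  · have hj1 : (1:ℝ) ≤ j := by exact_mod_cast hj
    have : (1 + α * j) ^ M ≤ 2 ^ M * (j:ℝ)^M := by
      rw [← mul_pow]
      gcongr
      nlinarith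
    calc _ ≤ 2 ^ M * (j:ℝ)^M * q ^ j := by gcongr
      _ ≤ _ := by rw [mul_add]; nlinarith [show 0 ≤ 2 ^ M * q^j by positivity]

/-- choose `M`. -/
lemma exists_M {α : ℝ} (hα : 0 < α) (x : ℝ) (hx : 0 ≤ x) :
    ∃ M : ℕ, 1 ≤ M ∧ x * (M:ℝ) ^ (-α) < 1 := by
  have h : Tendsto (fun n : ℕ => x * (n:ℝ) ^ (-α)) atTop (nhds (x * 0)) :=
    ((tendsto_rpow_neg_atTop hα).comp tendsto_natCast_atTop_atTop).const_mul x
  rw [mul_zero] at h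
  obtain ⟨M, h1, h2⟩ := ((h.eventually_lt_const one_pos).and (eventually_ge_atTop 1)).exists
  exact ⟨M, h2, h1⟩

lemma rpow_j {α : ℝ} {y : ℝ} (hy : 0 ≤ y) (j : ℕ) : y ^ (-(α * j)) = (y ^ (-α)) ^ j := by
  rw [← Real.rpow_natCast, ← Real.rpow_mul hy]; congr 1; ring

lemma inv_Gamma_le {s : ℝ} (hs : 0 ≤ s) {M : ℕ} (hM : 1 ≤ M) :
    (Real.Gamma (s + 1))⁻¹ ≤ (1 + s) ^ M * (M:ℝ) ^ (-s) := by
  refine le_of_tendsto (A_tendsto hs) ?_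
  filter_upwards [eventually_ge_atTop M] with n hn
  exact A_le' hs hM hn

lemma ml_bound {α : ℝ} (hα : 0 < α) (hα1 : α ≤ 1) (R : ℝ) (hR : 0 ≤ R) :
    ∃ u : ℕ → ℝ, Summable u ∧ ∀ j : ℕ, ∀ x : ℝ, |x| ≤ R →
      ‖x ^ j / Real.Gamma (α * j + 1)‖ ≤ u j := by
  obtain ⟨M, hM, hq⟩ := exists_M hα R hR
  refine ⟨_, summable_poly α M (q := R * (M:ℝ) ^ (-α)) (by positivity) hq hα.le hα1, ?_⟩
  intro j x hx
  have hg : 0 < Real.Gamma (α * j + 1) := Real.Gamma_pos_of_pos (by positivity)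
  rw [norm_div, norm_pow, Real.norm_eq_abs, Real.norm_of_nonneg hg.le, div_eq_mul_inv, mul_pow,
    ← rpow_j (by positivity)]
  have := inv_Gamma_le (s := α * j) (by positivity) hM
  calc _ ≤ R ^ j * ((1 + α * j) ^ M * (M:ℝ) ^ (-(α * j))) := by gcongr
    _ = _ := by ring

lemma continuous_ml {α : ℝ} (hα : 0 < α) (hα1 : α ≤ 1) : Continuous (mittagLeffler α) := by
  rw [continuous_iff_continuousAt]
  intro x
  obtain ⟨u, hu, hb⟩ := ml_bound hα hα1 (|x| + 1) (by positivity)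
  have : ContinuousOn (mittagLeffler α) (Metric.ball 0 (|x| + 1)) := by
    unfold mittagLeffler
    refine continuousOn_tsum (fun j => by fun_prop) hu (fun j y hy => hb j y ?_)
    simpa using (le_of_lt (by simpa using hy))
  exact this.continuousAt (Metric.isOpen_ball.mem_nhds (by simp))

noncomputable def fn (α μ : ℝ) (n : ℕ) : ℝ := ∑' j : ℕ, (-μ) ^ j * A (α * j) n

lemma fn_summable {α μ : ℝ} (hα : 0 < α) (hα1 : α ≤ 1) (h0 : 0 ≤ μ) (h1 : μ < 1) (n : ℕ) :
    Summable (fun j : ℕ => (-μ) ^ j * A (α * j) n) := by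
  refine Summable.of_norm_bounded (summable_poly α n h0 h1 hα.le hα1) (fun j => ?_)
  have hs : 0 ≤ α * j := by positivity
  rw [norm_mul, norm_pow, norm_neg, Real.norm_of_nonneg h0, Real.norm_of_nonneg (A_pos hs n).le,
    mul_comm]
  gcongr
  exact A_le_pow hs n

open PowerSeries in
lemma Fs_eq {α μ : ℝ} (hα : 0 < α) (hα1 : α ≤ 1) (h0 : 0 ≤ μ) (h1 : μ < 1) :
    (Bs α + C μ) * PowerSeries.mk (fn α μ) = Bs (α - 1) := by
  ext n
  have hS := fn_summable hα hα1 h0 h1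
  have e1 : coeff n (Bs α * PowerSeries.mk (fn α μ)) = ∑' j : ℕ, (-μ) ^ j * bc (α + (-1 - α * j)) n := by
    have : ∀ j : ℕ, (-μ) ^ j * bc (α + (-1 - α * j)) n =
        ∑ p ∈ Finset.HasAntidiagonal.antidiagonal n, bc α p.1 * ((-μ) ^ j * A (α * j) p.2) := by
      intro j
      have h := congrArg (coeff n) (Bs_add α (-1 - α * j))
      rw [coeff_mul] at h
      simp only [Bs, coeff_mk] at h
      rw [h, Finset.mul_sum]
      refine Finset.sum_congr rfl fun p _ => ?_
      rw [A]; ring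
    simp_rw [this]
    have hs : HasSum (fun j : ℕ => ∑ p ∈ Finset.HasAntidiagonal.antidiagonal n,
        bc α p.1 * ((-μ) ^ j * A (α * j) p.2))
        (∑ p ∈ Finset.HasAntidiagonal.antidiagonal n, bc α p.1 * fn α μ p.2) := by
      refine hasSum_sum fun p _ => ?_
      exact HasSum.mul_left (bc α p.1) (hS p.2).hasSum
    rw [hs.tsum_eq, coeff_mul]
    simp only [Bs, coeff_mk]
  have hterm : ∀ j : ℕ, (-μ) ^ (j+1) * bc (α + (-1 - α * ((j+1 : ℕ):ℝ))) n
      = -μ * ((-μ) ^ j * A (α * j) n) := by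
    intro j
    rw [A, show α + (-1 - α * ((j+1 : ℕ):ℝ)) = -1 - α * j by push_cast; ring]
    ring
  have hsum : Summable (fun j : ℕ => (-μ) ^ j * bc (α + (-1 - α * j)) n) := by
    rw [← summable_nat_add_iff 1]
    simp_rw [hterm]
    exact (hS n).mul_left _
  rw [add_mul, map_add, e1, hsum.tsum_eq_zero_add]
  simp_rw [hterm]
  rw [tsum_mul_left, coeff_C_mul, coeff_mk, ← fn]
  simp only [Bs, coeff_mk]
  simp
  ring_nf

lemma coeff_G_nonneg {α μ : ℝ} (hα : 0 < α) (hα1 : α ≤ 1) (h0 : 0 ≤ μ) (G : PowerSeries ℝ)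
    (hG : (Bs α + PowerSeries.C μ) * G = 1) (n : ℕ) : 0 ≤ PowerSeries.coeff n G := by
  induction n using Nat.strong_induction_on with
  | _ n ih =>
    have h := congrArg (PowerSeries.coeff n) hG
    rw [add_mul, map_add, PowerSeries.coeff_C_mul, PowerSeries.coeff_mul,
      Finset.Nat.sum_antidiagonal_eq_sum_range_succ_mk, Finset.sum_range_succ'] at h
    simp only [Bs, PowerSeries.coeff_mk, bc_zero, PowerSeries.coeff_one] at h
    have h2 : ∑ k ∈ Finset.range n, bc α (k+1) * PowerSeries.coeff (n - (k+1)) G ≤ 0 := by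
      refine Finset.sum_nonpos fun k hk => ?_
      have := Finset.mem_range.1 hk
      exact mul_nonpos_of_nonpos_of_nonneg (bc_nonpos hα.le hα1 k) (ih _ (by omega))
    have h3 : (0:ℝ) ≤ if n = 0 then 1 else 0 := by split_ifs <;> norm_num
    simp only [one_mul, Nat.sub_zero] at h
    have h4 : 0 ≤ (1 + μ) * PowerSeries.coeff n G := by linarith
    exact nonneg_of_mul_nonneg_right h4 (by linarith)

lemma fn_bounds {α μ : ℝ} (hα : 0 < α) (hα1 : α ≤ 1) (h0 : 0 ≤ μ) (h1 : μ < 1) (n : ℕ) :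
    0 ≤ fn α μ n ∧ fn α μ n * (1 + μ * A α n) ≤ 1 := by
  set P := Bs α + PowerSeries.C μ with hP
  set F := PowerSeries.mk (fn α μ) with hF
  have hPF : P * F = Bs (α - 1) := Fs_eq hα hα1 h0 h1
  have hc : PowerSeries.constantCoeff P ≠ 0 := by
    have : PowerSeries.constantCoeff P = 1 + μ := by
      rw [← PowerSeries.coeff_zero_eq_constantCoeff_apply, hP, map_add]
      simp [Bs, bc_zero]
    rw [this]; positivity
  have hPG : P * P⁻¹ = 1 := PowerSeries.mul_inv_cancel P hc
  have hg := coeff_G_nonneg hα hα1 h0 _ hPG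
  have hFG : F = Bs (α - 1) * P⁻¹ := by
    rw [← hPF]
    calc F = F * (P * P⁻¹) := by rw [hPG, mul_one]
      _ = _ := by ring
  have hfn : ∀ n, PowerSeries.coeff n F = fn α μ n := fun n => by simp [hF]
  have hnn : ∀ n, 0 ≤ fn α μ n := by
    intro n
    rw [← hfn, hFG, PowerSeries.coeff_mul]
    refine Finset.sum_nonneg fun p _ => mul_nonneg ?_ (hg _)
    simpa [Bs] using bc_nonneg (by linarith) _
  have hanti : Antitone (fn α μ) := by
    refine antitone_nat_of_succ_le fun n => ?_
    have h2 : (1 - PowerSeries.X) * F = 1 - PowerSeries.C μ * P⁻¹ := by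
      rw [← Bs_one, hFG, ← mul_assoc, ← Bs_add, show (1:ℝ) + (α - 1) = α by ring,
        show Bs α = P - PowerSeries.C μ by rw [hP]; ring, sub_mul, hPG]
    have h3 := congrArg (PowerSeries.coeff (n+1)) h2
    rw [sub_mul, one_mul, map_sub, map_sub, mul_comm PowerSeries.X, PowerSeries.coeff_succ_mul_X,
      hfn, hfn, PowerSeries.coeff_C_mul, PowerSeries.coeff_one] at h3
    simp at h3
    have := mul_nonneg h0 (hg (n+1))
    linarith
  refine ⟨hnn n, ?_⟩
  have h4 : F + PowerSeries.C μ * (Bs (-α) * F) = Bs (-1) := by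
    rw [show (-1:ℝ) = -α + (α - 1) by ring, Bs_add, ← hPF, hP, add_mul, mul_add, ← mul_assoc (Bs (-α)),
      ← Bs_add, show -α + α = 0 by ring, Bs_zero]
    ring
  have hm1 : ∀ n, bc (-1) n = 1 := by
    intro n
    induction n with
    | zero => exact bc_zero _
    | succ n ih =>
      have : (n:ℝ) + 1 ≠ 0 := by positivity
      rw [bc_succ, ih]; field_simp; ring
  have h5 := congrArg (PowerSeries.coeff n) h4
  rw [map_add, PowerSeries.coeff_C_mul, hfn, PowerSeries.coeff_mul] at h5
  have h6 : A α n = ∑ p ∈ Finset.HasAntidiagonal.antidiagonal n, bc (-α) p.1 := by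
    have h := congrArg (PowerSeries.coeff n) (Bs_add (-α) (-1))
    rw [PowerSeries.coeff_mul] at h
    simp only [Bs, PowerSeries.coeff_mk, hm1, mul_one] at h
    rw [← h, A]; congr 1; ring
  simp only [hfn] at h5
  simp only [Bs, PowerSeries.coeff_mk, hm1] at h5
  have h7 : A α n * fn α μ n ≤ ∑ p ∈ Finset.HasAntidiagonal.antidiagonal n, bc (-α) p.1 * fn α μ p.2 := by
    rw [h6, Finset.sum_mul]
    refine Finset.sum_le_sum fun p hp => ?_
    have := bc_nonneg (show -α ≤ 0 by linarith) p.1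
    gcongr
    apply hanti
    have := Finset.HasAntidiagonal.mem_antidiagonal.1 hp
    omega
  nlinarith [mul_le_mul_of_nonneg_left h7 h0]

lemma fn_tendsto {α x : ℝ} (hα : 0 < α) (hα1 : α ≤ 1) (hx : 0 ≤ x) :
    Tendsto (fun n : ℕ => fn α (x * (n:ℝ) ^ (-α)) n) atTop (nhds (mittagLeffler α (-x))) := by
  obtain ⟨M, hM, hq⟩ := exists_M hα x hx
  unfold fn mittagLeffler
  have hrw : ∀ n j : ℕ, (-(x * (n:ℝ) ^ (-α))) ^ j * A (α * j) n
      = (-x) ^ j * (A (α * j) n * (n:ℝ) ^ (-(α * j))) := by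
    intro n j
    rw [rpow_j (by positivity), ← neg_mul, mul_pow]; ring
  simp_rw [hrw]
  refine tendsto_tsum_of_dominated_convergence
    (summable_poly α M (q := x * (M:ℝ) ^ (-α)) (by positivity) hq hα.le hα1) ?_ ?_
  · intro j
    rw [div_eq_mul_inv]
    exact (A_tendsto (by positivity)).const_mul _
  · filter_upwards [eventually_ge_atTop M] with n hn j
    have hs : 0 ≤ α * j := by positivity
    have hA := (A_pos hs n).le
    rw [norm_mul, norm_pow, norm_neg, Real.norm_of_nonneg hx, Real.norm_of_nonneg (by positivity),
      mul_pow, ← rpow_j (by positivity)]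
    calc _ ≤ x ^ j * ((1 + α * j) ^ M * (M:ℝ) ^ (-(α * j))) := by
          exact mul_le_mul_of_nonneg_left (A_le' hs hM hn) (by positivity)
      _ = _ := by ring

lemma ml_bounds {α x : ℝ} (hα : 0 < α) (hα1 : α ≤ 1) (hx : 0 ≤ x) :
    0 ≤ mittagLeffler α (-x) ∧ mittagLeffler α (-x) * (1 + x * (Real.Gamma (α + 1))⁻¹) ≤ 1 := by
  have ht := fn_tendsto hα hα1 hx
  have hA := A_tendsto hα.le
  have hev : ∀ᶠ n : ℕ in atTop, x * (n:ℝ) ^ (-α) < 1 := by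
    have h : Tendsto (fun n : ℕ => x * (n:ℝ) ^ (-α)) atTop (nhds (x * 0)) :=
      ((tendsto_rpow_neg_atTop hα).comp tendsto_natCast_atTop_atTop).const_mul x
    rw [mul_zero] at h
    exact h.eventually_lt_const one_pos
  refine ⟨ge_of_tendsto ht ?_, le_of_tendsto (ht.mul ((hA.const_mul x).const_add 1)) ?_⟩
  · filter_upwards [hev] with n hn
    exact (fn_bounds hα hα1 (by positivity) hn n).1
  · filter_upwards [hev] with n hn
    have := (fn_bounds hα hα1 (by positivity) hn n).2
    calc _ = _ := by ring
      _ ≤ 1 := this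

lemma integrable_ml {α β c : ℝ} (hα : 0 < α) (hα1 : α ≤ 1) (hβ1 : 1 < β) (hc : 0 < c) :
    Integrable (fun y : ℝ => mittagLeffler α (-(c * |y| ^ β))) := by
  have hg : 0 < (Real.Gamma (α + 1))⁻¹ := inv_pos.2 (Real.Gamma_pos_of_pos (by linarith))
  set d := min 1 (c * (Real.Gamma (α + 1))⁻¹) with hd
  have hd0 : 0 < d := by rw [hd]; positivity
  have hd1 : d ≤ 1 := min_le_left _ _
  have hd2 : d ≤ c * (Real.Gamma (α + 1))⁻¹ := min_le_right _ _
  have hI : Integrable (fun y : ℝ => (2 ^ β / d) * (1 + ‖y‖) ^ (-β)) :=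
    (integrable_one_add_norm (by simpa using hβ1)).const_mul _
  refine hI.mono' ?_ ?_
  · apply Continuous.aestronglyMeasurable
    have := continuous_ml hα hα1
    refine this.comp ?_
    refine (continuous_const.mul (continuous_abs.rpow_const ?_)).neg
    intro x; right; linarith
  · refine Eventually.of_forall fun y => ?_
    have hx : 0 ≤ c * |y| ^ β := by positivity
    obtain ⟨h1, h2⟩ := ml_bounds hα hα1 hx
    rw [Real.norm_of_nonneg h1, Real.norm_eq_abs, Real.rpow_neg (by positivity)]
    have h3 : d * (1 + |y|) ^ β ≤ 2 ^ β * (1 + c * |y| ^ β * (Real.Gamma (α + 1))⁻¹) := by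
      have h4 : (1 + |y|) ^ β ≤ 2 ^ β * (1 + |y| ^ β) := by
        rcases le_total |y| 1 with h | h
        · calc (1 + |y|) ^ β ≤ 2 ^ β := by gcongr; linarith
            _ ≤ _ := le_mul_of_one_le_right (by positivity) (by linarith [show 0 ≤ |y| ^ β by positivity])
        · calc (1 + |y|) ^ β ≤ (2 * |y|) ^ β := by gcongr; linarith
            _ = 2 ^ β * |y| ^ β := Real.mul_rpow (by norm_num) (by positivity)
            _ ≤ _ := by gcongr; linarith
      calc _ ≤ d * (2 ^ β * (1 + |y| ^ β)) := by gcongr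
        _ = 2 ^ β * (d * 1 + d * |y| ^ β) := by ring
        _ ≤ 2 ^ β * (1 + (c * (Real.Gamma (α + 1))⁻¹) * |y| ^ β) := by gcongr; linarith
        _ = _ := by ring
    have h5 : 0 < (1 + |y|) ^ β := by positivity
    rw [div_mul_eq_mul_div, le_div_iff₀ hd0, ← div_eq_mul_inv, le_div_iff₀ h5]
    calc _ = mittagLeffler α (-(c * |y| ^ β)) * (d * (1 + |y|) ^ β) := by ring
      _ ≤ mittagLeffler α (-(c * |y| ^ β)) * (2 ^ β * (1 + c * |y| ^ β * (Real.Gamma (α + 1))⁻¹)) := by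
          gcongr
      _ = 2 ^ β * (mittagLeffler α (-(c * |y| ^ β)) * (1 + c * |y| ^ β * (Real.Gamma (α + 1))⁻¹)) := by ring
      _ ≤ 2 ^ β * 1 := by gcongr
      _ = _ := by ring

lemma integral_ml {α β c : ℝ} (hβ1 : 1 < β) (hc : 0 < c) :
    ∫ y : ℝ, mittagLeffler α (-(c * |y| ^ β)) =
      2 * (1 / β * c ^ (-(1 : ℝ) / β) *
          ∫ u in Ioi (0:ℝ), u ^ ((1 - β) / β) * mittagLeffler α (-u)) := by
  have hβ : 0 < β := by linarith
  rw [integral_comp_abs (f := fun y => mittagLeffler α (-(c * y ^ β)))]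
  congr 1
  -- y = c^(-1/β) * v
  have hc' : 0 < c ^ (-(1:ℝ)/β) := by positivity
  have h1 := integral_comp_mul_left_Ioi (fun y => mittagLeffler α (-(c * y ^ β))) 0 hc'
  rw [mul_zero, smul_eq_mul] at h1
  have h2 : ∫ y in Ioi (0:ℝ), mittagLeffler α (-(c * y ^ β)) =
      c ^ (-(1:ℝ)/β) * ∫ x in Ioi (0:ℝ), mittagLeffler α (-(c * (c ^ (-(1:ℝ)/β) * x) ^ β)) := by
    rw [h1]; field_simp
  have h3 := integral_comp_rpow_Ioi_of_pos (g := fun x => mittagLeffler α (-(x ^ β)))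
    (p := 1/β) (by positivity)
  have h4 : ∫ x in Ioi (0:ℝ), mittagLeffler α (-(c * (c ^ (-(1:ℝ)/β) * x) ^ β)) =
      ∫ x in Ioi (0:ℝ), mittagLeffler α (-(x ^ β)) := by
    refine setIntegral_congr_fun measurableSet_Ioi fun x hx => ?_
    have hx : 0 < x := hx
    rw [Real.mul_rpow hc'.le hx.le, ← Real.rpow_mul hc.le, div_mul_cancel₀ _ hβ.ne', Real.rpow_neg_one]
    congr 2
    field_simp
  rw [h2, h4, ← h3, mul_comm (1/β), mul_assoc]
  congr 1
  rw [← integral_const_mul]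
  refine setIntegral_congr_fun measurableSet_Ioi fun x hx => ?_
  have hx : 0 < x := hx
  simp only [smul_eq_mul]
  rw [← Real.rpow_mul hx.le, div_mul_cancel₀ _ hβ.ne', Real.rpow_one, mul_assoc]
  congr 3
  field_simp

lemma norm_term (h : ℤ → ℂ) (k : ℝ) (n : ℤ) : ‖h n * Complex.exp (Complex.I * k * n)‖ = ‖h n‖ := by
  rw [norm_mul, show Complex.I * k * n = ((k * n : ℝ) : ℂ) * Complex.I by push_cast; ring,
    Complex.norm_exp_ofReal_mul_I, mul_one]

lemma continuous_fourierZ {h : ℤ → ℂ} (hh : Summable (fun n => ‖h n‖)) :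
    Continuous (fourierZ h) := by
  unfold fourierZ
  exact continuous_tsum (fun n => by fun_prop) hh (fun n k => (norm_term h k n).le)

lemma norm_fourierZ {h : ℤ → ℂ} (hh : Summable (fun n => ‖h n‖)) (k : ℝ) :
    ‖fourierZ h k‖ ≤ ∑' n, ‖h n‖ :=
  tsum_of_norm_bounded hh.hasSum (fun n => (norm_term h k n).le)

end GDE

open GDE in
/-- for the stepwise time-dependent GDE, the asymptotic decay exponent
`t^{-α/β}` depends only on the operator acting after the switching time, not on the
intermediate state `h`:
`t^{α/β}·(1/2π)∫ e^{-ikm} E_α(-c tᵅ |k|^β) ĥ(k) dk → (1/(πβ)) c^{-1/β} I₀(α,β) ∑_n h(n)`. -/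
theorem GDE_stepwise_asymptotics
    (α β c : ℝ) (hα : 0 < α) (hα1 : α ≤ 1) (hβ1 : 1 < β) (hβ2 : β ≤ 2) (hc : 0 < c)
    (h : ℤ → ℂ) (hh : Summable (fun n => ‖h n‖)) (m : ℤ) :
    Tendsto
      (fun t : ℝ => ((t ^ (α / β) : ℝ) : ℂ) * ((1 / (2 * (π : ℂ))) *
        ∫ k in (-π)..π, Complex.exp (-Complex.I * k * m) *
          ((mittagLeffler α (-c * t ^ α * |k| ^ β) : ℝ) : ℂ) * fourierZ h k))
      atTop
      (nhds (((1 / (π * β) * c ^ (-(1 : ℝ) / β) *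
          ∫ u in Ioi (0:ℝ), u ^ ((1 - β) / β) * mittagLeffler α (-u) : ℝ) : ℂ) *
        ∑' n : ℤ, h n)) := by
  have hβ : 0 < β := by linarith
  set φ : ℝ → ℂ := fun k => Complex.exp (-Complex.I * k * m) * fourierZ h k with hφ
  have hφc : Continuous φ := by
    have := continuous_fourierZ hh
    rw [hφ]; fun_prop
  set K := ∑' n, ‖h n‖ with hK
  have hφb : ∀ k, ‖φ k‖ ≤ K := by
    intro k
    rw [hφ]
    simp only
    rw [norm_mul, show -Complex.I * k * m = ((-(k * m) : ℝ) : ℂ) * Complex.I by push_cast; ring,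
      Complex.norm_exp_ofReal_mul_I, one_mul]
    exact norm_fourierZ hh k
  have hφ0 : φ 0 = ∑' n, h n := by simp [hφ, fourierZ]
  set g : ℝ → ℝ := fun y => mittagLeffler α (-(c * |y| ^ β)) with hgdef
  have hgI : Integrable g := integrable_ml hα hα1 hβ1 hc
  have hgc : Continuous g := by
    refine (continuous_ml hα hα1).comp ?_
    refine (continuous_const.mul (continuous_abs.rpow_const ?_)).neg
    intro x; right; linarith
  have hT : Tendsto (fun t : ℝ => t ^ (α / β)) atTop atTop := tendsto_rpow_atTop (by positivity)
  -- the limit in the scale parameter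
  have hlim : Tendsto (fun T : ℝ => ∫ y : ℝ, (Ioc (-(T * π)) (T * π)).indicator
      (fun y => φ (T⁻¹ * y) * (g y : ℂ)) y) atTop (nhds (∫ y, φ 0 * (g y : ℂ))) := by
    refine tendsto_integral_filter_of_dominated_convergence (fun y => K * ‖g y‖) ?_ ?_
      (hgI.norm.const_mul K) ?_
    · refine Eventually.of_forall fun T => ?_
      refine AEStronglyMeasurable.indicator ?_ measurableSet_Ioc
      apply Continuous.aestronglyMeasurable
      fun_prop
    · refine Eventually.of_forall fun T => Eventually.of_forall fun y => ?_
      refine (norm_indicator_le_norm_self _ _).trans ?_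
      rw [norm_mul, Complex.norm_real]
      gcongr
      exact hφb _
    · refine Eventually.of_forall fun y => ?_
      have h1 : Tendsto (fun T : ℝ => φ (T⁻¹ * y) * (g y : ℂ)) atTop (nhds (φ 0 * (g y : ℂ))) := by
        refine Tendsto.mul_const _ ((hφc.tendsto 0).comp ?_)
        simpa using tendsto_inv_atTop_zero.mul_const y
      refine h1.congr' ?_
      have h2 : ∀ᶠ T : ℝ in atTop, |y| < T * π :=
        (tendsto_id.atTop_mul_const Real.pi_pos).eventually_gt_atTop |y|
      filter_upwards [h2] with T hT
      rw [indicator_of_mem]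
      rw [abs_lt] at hT
      exact ⟨hT.1, hT.2.le⟩
  have hlim2 := ((hlim.comp hT).const_mul (1 / (2 * (π : ℂ))))
  have hval : (1 / (2 * (π : ℂ))) * ∫ y, φ 0 * (g y : ℂ) =
      (((1 / (π * β) * c ^ (-(1 : ℝ) / β) *
          ∫ u in Ioi (0:ℝ), u ^ ((1 - β) / β) * mittagLeffler α (-u) : ℝ) : ℂ) *
        ∑' n : ℤ, h n) := by
    have hio : ∫ y, (g y : ℂ) = ((∫ y, g y : ℝ) : ℂ) := integral_ofReal
    rw [integral_const_mul, hio, hφ0, hgdef, integral_ml hβ1 hc]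
    have hpi : (π : ℂ) ≠ 0 := by exact_mod_cast Real.pi_ne_zero
    have hb : (β : ℂ) ≠ 0 := by exact_mod_cast hβ.ne'
    generalize ∫ u in Ioi (0:ℝ), u ^ ((1 - β) / β) * mittagLeffler α (-u) = J
    generalize c ^ (-(1 : ℝ) / β) = L
    push_cast
    field_simp
  rw [hval] at hlim2
  refine hlim2.congr' ?_
  filter_upwards [eventually_gt_atTop 0] with t ht
  set T := t ^ (α / β) with hTdef
  have hT0 : 0 < T := by positivity
  have hTβ : T ^ β = t ^ α := by
    rw [hTdef, ← Real.rpow_mul ht.le, div_mul_cancel₀ _ hβ.ne']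
  simp only [Function.comp]
  rw [← hTdef, integral_indicator measurableSet_Ioc,
    ← intervalIntegral.integral_of_le (by nlinarith [Real.pi_pos])]
  have h1 := intervalIntegral.integral_comp_mul_left (a := -π) (b := π)
    (fun y => φ (T⁻¹ * y) * (g y : ℂ)) hT0.ne'
  rw [mul_neg] at h1
  have h2 : ∫ y in (-(T * π))..(T * π), φ (T⁻¹ * y) * (g y : ℂ) =
      (T : ℂ) * ∫ k in (-π)..π, φ (T⁻¹ * (T * k)) * (g (T * k) : ℂ) := by
    rw [h1, Complex.real_smul]
    have : (T : ℂ) ≠ 0 := by exact_mod_cast hT0.ne'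
    push_cast
    field_simp
  rw [h2, mul_left_comm]
  congr 2
  refine intervalIntegral.integral_congr fun k _ => ?_
  simp only [hφ, hgdef]
  rw [inv_mul_cancel_left₀ hT0.ne', abs_mul, abs_of_pos hT0,
    Real.mul_rpow hT0.le (abs_nonneg k), hTβ, show -(c * (t ^ α * |k| ^ β)) = -c * t ^ α * |k| ^ β by ring]
  ring
end
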